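/- arXiv:2602.10292 — 2 statements merged into one kernel-verified Lean document; each statement's English description precedes it below -/
import Mathlib

section
/- Fix positive integers k and t with k > 2t+1. There exists n₀ such that for all n > n₀, the independence number α(G(n,k,t)) equals C(n-t-1, k-t-1). -/
/-- The independence number of the generalized Johnson graph `G(n,k,t)`:
the maximum size of a family of `k`-element subsets of `[n] = {1,…,n}`
containing no two distinct sets whose intersection has exactly `t` elements. -/
def alphaJ (n k t : ℕ) : ℕ :=
  ((((Finset.Icc 1 n).powersetCard k).powerset).filter
    (fun F => ∀ A ∈ F, ∀ B ∈ F, A ≠ B → (A ∩ B).card ≠ t)).sup Finset.card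

/-- A double count of incidences between a vertex set and a family of edges, in the spirit of
Motzkin's proof of the de Bruijn–Erdős theorem. -/
theorem exists_card_le_degree_of_notMem {α ι : Type*} [DecidableEq α] (M : ι → Finset α)
    (V : Finset α) (I : Finset ι) (hV : V.card = I.card + 1)
    (hdeg : ∀ u ∈ V, (I.filter fun i => u ∈ M i).card < I.card) :
    ∃ i ∈ I, ∃ u ∈ V, u ∉ M i ∧ (M i ∩ V).card ≤ (I.filter fun i => u ∈ M i).card := by
  classical
  by_contra! hcon
  set d : α → ℕ := fun u => (I.filter fun i => u ∈ M i).card with hd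
  set s : ι → ℕ := fun i => (M i ∩ V).card with hs
  have hsum : ∑ u ∈ V, (d u : ℚ) = ∑ i ∈ I, (s i : ℚ) := by
    have h := Finset.sum_card_bipartiteAbove_eq_sum_card_bipartiteBelow
      (s := V) (t := I) (fun u i => u ∈ M i)
    have h1 : ∀ i, (V.bipartiteBelow (fun u i => u ∈ M i) i).card = s i := by
      intro i
      congr 1
      ext u
      simp [Finset.mem_bipartiteBelow, and_comm]
    simp only [h1] at h
    exact_mod_cast h
  have hleft : ∑ u ∈ V, (d u : ℚ) =
      ∑ u ∈ V, ∑ i ∈ I.filter (fun i => u ∉ M i), (d u : ℚ) / (I.card - d u) := by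
    refine Finset.sum_congr rfl fun u hu => ?_
    have h1 : ((I.filter fun i => u ∉ M i).card : ℚ) = I.card - d u := by
      have := Finset.card_filter_add_card_filter_not (s := I) (fun i => u ∈ M i)
      rw [eq_sub_iff_add_eq, add_comm]
      exact_mod_cast this
    have h2 : (I.card : ℚ) - d u ≠ 0 := by
      have : (d u : ℚ) < I.card := by exact_mod_cast hdeg u hu
      linarith
    rw [Finset.sum_const, nsmul_eq_mul, h1]
    field_simp
  have hright : ∑ u ∈ V, ∑ i ∈ I.filter (fun i => u ∉ M i), (s i : ℚ) / (V.card - s i) ≤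
      ∑ i ∈ I, (s i : ℚ) := by
    have hcomm : ∑ u ∈ V, ∑ i ∈ I.filter (fun i => u ∉ M i), (s i : ℚ) / (V.card - s i) =
        ∑ i ∈ I, ∑ u ∈ V.filter (fun u => u ∉ M i), (s i : ℚ) / (V.card - s i) :=
      Finset.sum_comm' (by intro u i; simp only [Finset.mem_filter]; tauto)
    rw [hcomm]
    refine Finset.sum_le_sum fun i _ => ?_
    have h1 : ((V.filter fun u => u ∉ M i).card : ℚ) = V.card - s i := by
      have := Finset.card_filter_add_card_filter_not (s := V) (fun u => u ∈ M i)
      rw [eq_sub_iff_add_eq, add_comm]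
      have h2 : s i = (V.filter fun u => u ∈ M i).card := by
        change (M i ∩ V).card = _
        congr 1
        ext u
        simp [and_comm]
      rw [h2]
      exact_mod_cast this
    rw [Finset.sum_const, nsmul_eq_mul, h1]
    by_cases h2 : (V.card : ℚ) - s i = 0
    · rw [h2]
      simp
    · exact (mul_div_cancel₀ _ h2).le
  have hstrict : ∑ u ∈ V, ∑ i ∈ I.filter (fun i => u ∉ M i), (d u : ℚ) / (I.card - d u) <
      ∑ u ∈ V, ∑ i ∈ I.filter (fun i => u ∉ M i), (s i : ℚ) / (V.card - s i) := by
    have hVne : V.Nonempty := by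
      rw [← Finset.card_pos]
      omega
    refine Finset.sum_lt_sum_of_nonempty hVne fun u hu => ?_
    have hne : (I.filter fun i => u ∉ M i).Nonempty := by
      rw [← Finset.card_pos]
      have := Finset.card_filter_add_card_filter_not (s := I) (fun i => u ∈ M i)
      have := hdeg u hu
      omega
    refine Finset.sum_lt_sum_of_nonempty hne fun i hi => ?_
    obtain ⟨hiI, hui⟩ := Finset.mem_filter.1 hi
    have h1 : (d u : ℚ) + 1 ≤ s i := by exact_mod_cast hcon i hiI u hu hui
    have h2 : (d u : ℚ) < I.card := by exact_mod_cast hdeg u hu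
    have h3 : (s i : ℚ) < V.card := by
      have : s i < V.card := Finset.card_lt_card
        ⟨Finset.inter_subset_right, fun h => hui (Finset.mem_inter.1 (h hu)).1⟩
      exact_mod_cast this
    have h4 : (V.card : ℚ) = I.card + 1 := by exact_mod_cast hV
    rw [div_lt_div_iff₀ (by linarith) (by linarith), h4]
    nlinarith [mul_le_mul_of_nonneg_right h1 (Nat.cast_nonneg (α := ℚ) I.card)]
  linarith

/-- Vertices of `R₀` are put into the solution, vertices of `Q` are kept out of it. -/
theorem exists_card_add_card_filter_subset_of_contract {α ι : Type*} [DecidableEq α]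
    (M : ι → Finset α) (V R₀ Q : Finset α) (I : Finset ι) (τ' : ℕ) (hR₀ : R₀ ⊆ V)
    (hdis : Disjoint R₀ Q)
    (h : ∃ R ⊆ V \ (R₀ ∪ Q), R.card + ((I.filter fun i => Disjoint (M i ∩ V) Q ∧
      ¬ M i ∩ V ⊆ R₀).filter fun i => M i ∩ (V \ (R₀ ∪ Q)) ⊆ R).card = τ') :
    ∃ R ⊆ V, R.card + (I.filter fun i => M i ∩ V ⊆ R).card =
      R₀.card + (I.filter fun i => M i ∩ V ⊆ R₀).card + τ' := by
  classical
  obtain ⟨R, hRV, hR⟩ := h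
  refine ⟨R₀ ∪ R, Finset.union_subset hR₀ (hRV.trans Finset.sdiff_subset), ?_⟩
  have hRR : Disjoint R₀ R := by
    rw [Finset.disjoint_left]
    intro x hx hxR
    have := hRV hxR
    simp only [Finset.mem_sdiff, Finset.mem_union] at this
    tauto
  have hsplit : (I.filter fun i => M i ∩ V ⊆ R₀ ∪ R) = (I.filter fun i => M i ∩ V ⊆ R₀) ∪
      ((I.filter fun i => Disjoint (M i ∩ V) Q ∧ ¬ M i ∩ V ⊆ R₀).filter
        fun i => M i ∩ (V \ (R₀ ∪ Q)) ⊆ R) := by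
    ext i
    simp only [Finset.mem_filter, Finset.mem_union]
    constructor
    · rintro ⟨hi, hM⟩
      by_cases h0 : M i ∩ V ⊆ R₀
      · exact Or.inl ⟨hi, h0⟩
      · refine Or.inr ⟨⟨hi, ?_, h0⟩, ?_⟩
        · rw [Finset.disjoint_left]
          intro x hx hxQ
          rcases Finset.mem_union.1 (hM hx) with h1 | h1
          · exact Finset.disjoint_left.1 hdis h1 hxQ
          · have := hRV h1
            simp only [Finset.mem_sdiff, Finset.mem_union] at this
            tauto
        · intro x hx
          simp only [Finset.mem_inter, Finset.mem_sdiff, Finset.mem_union] at hx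
          have := hM (Finset.mem_inter.2 ⟨hx.1, hx.2.1⟩)
          rw [Finset.mem_union] at this
          tauto
    · rintro (⟨hi, h0⟩ | ⟨⟨hi, hQ, -⟩, h1⟩)
      · exact ⟨hi, h0.trans Finset.subset_union_left⟩
      · refine ⟨hi, fun x hx => ?_⟩
        have hxQ := Finset.disjoint_left.1 hQ hx
        have hx' := Finset.mem_inter.1 hx
        by_cases hx0 : x ∈ R₀
        · exact Finset.mem_union_left _ hx0
        · refine Finset.mem_union_right _ (h1 ?_)
          simp only [Finset.mem_inter, Finset.mem_sdiff, Finset.mem_union]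
          tauto
  rw [hsplit, Finset.card_union_of_disjoint hRR, Finset.card_union_of_disjoint]
  · omega
  · rw [Finset.disjoint_left]
    intro i hi hi'
    simp only [Finset.mem_filter] at hi hi'
    tauto

/-- If a hypergraph has more vertices than (nonempty) edges, then for every `τ` smaller than the
number of vertices some vertex set `R` satisfies `|R| + e(R) = τ`. -/
theorem exists_card_add_card_filter_subset {α ι : Type*} [DecidableEq α]
    (M : ι → Finset α) (m : ℕ) : ∀ (V : Finset α) (I : Finset ι) (τ : ℕ), V.card = m →
      (∀ i ∈ I, (M i ∩ V).Nonempty) → I.card + 1 ≤ V.card → τ + 1 ≤ V.card →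
      ∃ R ⊆ V, R.card + (I.filter fun i => M i ∩ V ⊆ R).card = τ := by
  classical
  induction m using Nat.strong_induction_on with
  | _ m ih =>
  intro V I τ hVm hne hIV hτ
  have key : ∀ (R₀ Q : Finset α) (τ' : ℕ), R₀ ⊆ V → Q ⊆ V → Disjoint R₀ Q →
      0 < R₀.card + Q.card →
      I.card + R₀.card + Q.card + 1 ≤ V.card + (I.filter fun i => M i ∩ V ⊆ R₀).card +
        (I.filter fun i => ¬ Disjoint (M i ∩ V) Q).card →
      τ' + 1 + R₀.card + Q.card ≤ V.card →
      τ = R₀.card + (I.filter fun i => M i ∩ V ⊆ R₀).card + τ' →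
      ∃ R ⊆ V, R.card + (I.filter fun i => M i ∩ V ⊆ R).card = τ := by
    intro R₀ Q τ' hR₀ hQ hdis hpos hcard hτ' hττ
    rw [hττ]
    have hcV : (V \ (R₀ ∪ Q)).card + (R₀.card + Q.card) = V.card := by
      rw [← Finset.card_union_of_disjoint hdis]
      exact Finset.card_sdiff_add_card_eq_card (Finset.union_subset hR₀ hQ)
    have hcI : (I.filter fun i => Disjoint (M i ∩ V) Q ∧ ¬ M i ∩ V ⊆ R₀).card +
        (I.filter fun i => M i ∩ V ⊆ R₀).card +
        (I.filter fun i => ¬ Disjoint (M i ∩ V) Q).card = I.card := by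
      rw [← Finset.card_union_of_disjoint, ← Finset.card_union_of_disjoint]
      · congr 1
        ext i
        simp only [Finset.mem_union, Finset.mem_filter]
        tauto
      · rw [Finset.disjoint_left]
        intro i hi hi'
        simp only [Finset.mem_union, Finset.mem_filter] at hi hi'
        rcases hi with hi | hi
        · tauto
        · exact hi'.2 (Finset.disjoint_of_subset_left hi.2 hdis)
      · rw [Finset.disjoint_left]
        intro i hi hi'
        simp only [Finset.mem_filter] at hi hi'
        tauto
    refine exists_card_add_card_filter_subset_of_contract M V R₀ Q I τ' hR₀ hdis
      (ih _ (by omega) _ _ τ' rfl ?_ (by omega) (by omega))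
    intro i hi
    simp only [Finset.mem_filter] at hi
    obtain ⟨x, hx, hx0⟩ := Finset.not_subset.1 hi.2.2
    have hxQ := Finset.disjoint_left.1 hi.2.1 hx
    refine ⟨x, ?_⟩
    simp only [Finset.mem_inter, Finset.mem_sdiff, Finset.mem_union] at hx ⊢
    tauto
  have hdegQ : ∀ u ∈ V, (I.filter fun i => ¬ Disjoint (M i ∩ V) {u}) =
      I.filter fun i => u ∈ M i := by
    intro u hu
    ext i
    simp [hu]
  have hempty : (I.filter fun i => M i ∩ V ⊆ ∅) = ∅ := by
    rw [Finset.filter_eq_empty_iff]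
    intro i hi h
    exact (hne i hi).ne_empty (Finset.subset_empty.1 h)
  by_cases hI0 : I = ∅
  · obtain ⟨R, hR, hRc⟩ := Finset.exists_subset_card_eq (s := V) (n := τ) (by omega)
    exact ⟨R, hR, by simp [hI0, hRc]⟩
  by_cases hτ2 : τ + 2 ≤ V.card
  · obtain ⟨i, hi⟩ := Finset.nonempty_of_ne_empty hI0
    obtain ⟨v, hv⟩ := hne i hi
    obtain ⟨hvM, hvV⟩ := Finset.mem_inter.1 hv
    have hd : 0 < (I.filter fun i => v ∈ M i).card :=
      Finset.card_pos.2 ⟨i, Finset.mem_filter.2 ⟨hi, hvM⟩⟩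
    refine key ∅ {v} τ (by simp) (by simpa using hvV) (by simp) (by simp) ?_ (by simp; omega) ?_
    · rw [hdegQ v hvV]
      simp
      omega
    · rw [hempty]
      simp
  by_cases hfull : ∃ u ∈ V, I.card ≤ (I.filter fun i => u ∈ M i).card
  · obtain ⟨u, hu, hdu⟩ := hfull
    refine ⟨V.erase u, Finset.erase_subset _ _, ?_⟩
    have hall := Finset.eq_of_subset_of_card_le (Finset.filter_subset _ _) hdu
    rw [Finset.filter_eq_empty_iff.2, Finset.card_erase_of_mem hu]
    · simp
      omega
    · intro i hi h
      rw [← hall] at hi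
      have := h (Finset.mem_inter.2 ⟨(Finset.mem_filter.1 hi).2, hu⟩)
      simp at this
  push Not at hfull
  by_cases hslack : I.card + 2 ≤ V.card
  · obtain ⟨v, hv⟩ : V.Nonempty := Finset.card_pos.1 (by omega)
    have hle : (I.filter fun i => M i ∩ V ⊆ {v}).card ≤ (I.filter fun i => v ∈ M i).card := by
      refine Finset.card_le_card fun i hi => ?_
      obtain ⟨hiI, hiv⟩ := Finset.mem_filter.1 hi
      obtain ⟨x, hx⟩ := hne i hiI
      have := Finset.mem_singleton.1 (hiv hx)
      exact Finset.mem_filter.2 ⟨hiI, this ▸ (Finset.mem_inter.1 hx).1⟩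
    have := hfull v hv
    refine key {v} ∅ (τ - 1 - (I.filter fun i => M i ∩ V ⊆ {v}).card) (by simpa using hv)
      (by simp) (by simp) (by simp) ?_ ?_ ?_
    · simp only [Finset.card_singleton, Finset.card_empty]
      omega
    · simp only [Finset.card_singleton, Finset.card_empty]
      omega
    · simp only [Finset.card_singleton]
      omega
  obtain ⟨i, hi, u, hu, hui, hle⟩ :=
    exists_card_le_degree_of_notMem M V I (by omega) hfull
  have hμ : 0 < (I.filter fun j => M j ∩ V ⊆ M i ∩ V).card :=
    Finset.card_pos.2 ⟨i, Finset.mem_filter.2 ⟨hi, subset_rfl⟩⟩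
  have hsum : (I.filter fun j => M j ∩ V ⊆ M i ∩ V).card + (I.filter fun j => u ∈ M j).card ≤
      I.card := by
    rw [← Finset.card_union_of_disjoint]
    · exact Finset.card_le_card (Finset.union_subset (Finset.filter_subset _ _)
        (Finset.filter_subset _ _))
    · rw [Finset.disjoint_left]
      intro j hj hj'
      exact hui (Finset.mem_inter.1 ((Finset.mem_filter.1 hj).2
        (Finset.mem_inter.2 ⟨(Finset.mem_filter.1 hj').2, hu⟩))).1
  have hsV : (M i ∩ V).card + 1 ≤ V.card := Finset.card_lt_card
    ⟨Finset.inter_subset_right, fun h => hui (Finset.mem_inter.1 (h hu)).1⟩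
  refine key (M i ∩ V) {u} (τ - (M i ∩ V).card - (I.filter fun j => M j ∩ V ⊆ M i ∩ V).card)
    Finset.inter_subset_right (by simpa using hu) (by simp [hui]) (by simp) ?_ ?_ ?_
  · rw [hdegQ u hu]
    simp only [Finset.card_singleton]
    omega
  · simp only [Finset.card_singleton]
    omega
  · omega

/-- If the sets `E x`, `x ∈ X`, have a union with fewer than `|X|` elements, then `|J| + |⋃_J E|`
takes all values from `|⋃_X E| + 1` to `|X| + |⋃_X E|`. -/
theorem exists_card_add_card_biUnion {α β : Type*} [DecidableEq α] [DecidableEq β]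
    (X : Finset α) (E : α → Finset β) (w : ℕ) (hX : (X.biUnion E).card + 1 ≤ X.card)
    (hw : (X.biUnion E).card + 1 ≤ w) (hw' : w ≤ X.card + (X.biUnion E).card) :
    ∃ J ⊆ X, J.card + (J.biUnion E).card = w := by
  obtain ⟨R, hR, hRτ⟩ := exists_card_add_card_filter_subset
    (fun c : β => X.filter fun x => c ∈ E x) X.card X (X.biUnion E)
    (X.card + (X.biUnion E).card - w) rfl
    (by
      intro c hc
      obtain ⟨x, hx, hcx⟩ := Finset.mem_biUnion.1 hc
      exact ⟨x, by simp [hx, hcx]⟩)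
    hX (by omega)
  refine ⟨X \ R, Finset.sdiff_subset, ?_⟩
  have h1 : (X \ R).card + R.card = X.card := Finset.card_sdiff_add_card_eq_card hR
  have h2 : (X \ R).biUnion E = (X.biUnion E).filter
      fun c => ¬ (X.filter fun x => c ∈ E x) ∩ X ⊆ R := by
    ext c
    simp only [Finset.mem_biUnion, Finset.mem_sdiff, Finset.mem_filter, Finset.not_subset,
      Finset.mem_inter]
    constructor
    · rintro ⟨x, ⟨hx, hxR⟩, hc⟩
      exact ⟨⟨x, hx, hc⟩, x, ⟨⟨hx, hc⟩, hx⟩, hxR⟩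
    · rintro ⟨-, x, ⟨⟨hx, hc⟩, -⟩, hxR⟩
      exact ⟨x, ⟨hx, hxR⟩, hc⟩
  have h3 := Finset.card_filter_add_card_filter_not (s := X.biUnion E)
    (fun c => (X.filter fun x => c ∈ E x) ∩ X ⊆ R)
  rw [h2]
  omega

/-- `𝓕` contains a sunflower with at least `s` members and kernel `Y`. -/
def IsKernel {α : Type*} [DecidableEq α] (s : ℕ) (𝓕 : Finset (Finset α)) (Y : Finset α) : Prop :=
  ∃ 𝓟 ⊆ 𝓕, s ≤ 𝓟.card ∧ (∀ F ∈ 𝓟, Y ⊆ F) ∧ ∀ F ∈ 𝓟, ∀ F' ∈ 𝓟, F ≠ F' → F ∩ F' = Y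

/-- The traces of `𝓗` on each of its members are kernels of sunflowers, and are closed under
intersection. -/
def IsHomogeneous {α : Type*} [DecidableEq α] (s : ℕ) (𝓗 : Finset (Finset α)) : Prop :=
  (∀ F ∈ 𝓗, ∀ F₁ ∈ 𝓗, ∀ F₂ ∈ 𝓗, F₁ ≠ F → F₂ ≠ F →
    ∃ F₃ ∈ 𝓗, F₃ ≠ F ∧ F ∩ F₃ = F ∩ F₁ ∩ F₂) ∧
  ∀ F ∈ 𝓗, ∀ F' ∈ 𝓗, F ≠ F' → IsKernel s 𝓗 (F ∩ F')

/-- `F` is the only member of `𝓕` containing `A`. -/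
def IsOwn {α : Type*} (𝓕 : Finset (Finset α)) (F A : Finset α) : Prop :=
  A ⊆ F ∧ ∀ F' ∈ 𝓕, A ⊆ F' → F' = F

/-- Every set `D ∪ Y` with `Y ⊂ F \ D` is the kernel of a sunflower in `𝓕`. -/
def IsCore {α : Type*} [DecidableEq α] (s : ℕ) (𝓕 : Finset (Finset α)) (F D : Finset α) : Prop :=
  D ⊆ F ∧ ∀ Y ⊂ F \ D, IsKernel s 𝓕 (D ∪ Y)

section Kernels

variable {α : Type*} [DecidableEq α] {s k t : ℕ} {𝓕 𝓗 : Finset (Finset α)} {Y Y' F F' D D' : Finset α}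

theorem IsKernel.mono (h : IsKernel s 𝓗 Y) (hsub : 𝓗 ⊆ 𝓕) : IsKernel s 𝓕 Y :=
  let ⟨𝓟, h1, h2⟩ := h
  ⟨𝓟, h1.trans hsub, h2⟩

theorem IsKernel.exists_inter_eq (h : IsKernel s 𝓕 Y) (S : Finset α) (hS : S.card < s) :
    ∃ F ∈ 𝓕, Y ⊆ F ∧ F ∩ S = Y ∩ S := by
  obtain ⟨𝓟, h𝓟, hs, hY, hdis⟩ := h
  by_contra! hcon
  have hx : ∀ F ∈ 𝓟, ∃ x ∈ S, x ∈ F ∧ x ∉ Y := by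
    intro F hF
    by_contra! hx
    refine hcon F (h𝓟 hF) (hY F hF) ?_
    ext x
    have := hx x
    have := @hY F hF x
    simp only [Finset.mem_inter]
    tauto
  have hα : Nonempty α := by
    obtain ⟨F, hF⟩ : 𝓟.Nonempty := Finset.card_pos.1 (by omega)
    exact ⟨(hx F hF).choose⟩
  choose! x hxS hxF hxY using hx
  have := Finset.card_le_card_of_injOn x hxS (by
    intro F hF F' hF' hxx
    by_contra hne
    have := hdis F hF F' hF' hne
    refine hxY F hF ?_
    rw [← this]
    exact Finset.mem_inter.2 ⟨hxF F hF, hxx ▸ hxF F' hF'⟩)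
  omega

theorem IsKernel.exists_inter_eq_inter (hk : ∀ F ∈ 𝓕, F.card = k) (hks : k < s)
    (h : IsKernel s 𝓕 Y) (h' : IsKernel s 𝓕 Y') :
    ∃ F ∈ 𝓕, ∃ F' ∈ 𝓕, Y ⊆ F ∧ Y' ⊆ F' ∧ F ∩ F' = Y ∩ Y' := by
  obtain ⟨F₀, hF₀, hF₀Y, -⟩ := h'.exists_inter_eq ∅ (by simp; omega)
  have h1 : Y'.card < s := (Finset.card_le_card hF₀Y).trans_lt (hk F₀ hF₀ ▸ hks)
  obtain ⟨F, hF, hYF, hFY⟩ := h.exists_inter_eq Y' h1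
  obtain ⟨F', hF', hYF', hFF⟩ := h'.exists_inter_eq F (by rwa [hk F hF])
  refine ⟨F, hF, F', hF', hYF, hYF', ?_⟩
  rw [Finset.inter_comm, hFF, Finset.inter_comm, hFY]

theorem IsKernel.card_inter_ne (hk : ∀ F ∈ 𝓕, F.card = k) (htk : t < k) (hks : k < s)
    (hav : ∀ A ∈ 𝓕, ∀ B ∈ 𝓕, A ≠ B → (A ∩ B).card ≠ t)
    (h : IsKernel s 𝓕 Y) (h' : IsKernel s 𝓕 Y') : (Y ∩ Y').card ≠ t := by
  obtain ⟨F, hF, F', hF', -, -, hFF⟩ := h.exists_inter_eq_inter hk hks h'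
  rw [← hFF]
  refine fun hc => hav F hF F' hF' ?_ hc
  rintro rfl
  rw [Finset.inter_self, hk F hF] at hc
  omega

theorem IsKernel.card_inter_mem_ne (hk : ∀ F ∈ 𝓕, F.card = k) (htk : t < k) (hks : k < s)
    (hav : ∀ A ∈ 𝓕, ∀ B ∈ 𝓕, A ≠ B → (A ∩ B).card ≠ t)
    (h : IsKernel s 𝓕 Y) (hF' : F' ∈ 𝓕) : (Y ∩ F').card ≠ t := by
  obtain ⟨F, hF, -, hFF⟩ := h.exists_inter_eq F' (by rwa [hk F' hF'])
  rw [← hFF]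
  refine fun hc => hav F hF F' hF' ?_ hc
  rintro rfl
  rw [Finset.inter_self, hk F hF] at hc
  omega

end Kernels

section UnionClosed

variable {α : Type*} [DecidableEq α] {C : Finset α → Prop}

theorem biUnion_mem_of_union_closed {ι : Type*} (hun : ∀ a b, C a → C b → C (a ∪ b))
    (f : ι → Finset α) (J : Finset ι) (hJ : J.Nonempty) (hf : ∀ x ∈ J, C (f x)) :
    C (J.biUnion f) := by
  classical
  induction hJ using Finset.Nonempty.cons_induction with
  | singleton a => simpa using hf a (by simp)
  | cons a J ha hJ ih =>
    rw [Finset.cons_eq_insert, Finset.biUnion_insert]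
    exact hun _ _ (hf a (by simp)) (ih fun x hx => hf x (by simp [hx]))

/-- If `C` contains sets `f x` with `x ∈ f x ⊆ D ∪ {x}` for all `x ∈ Q`, then it contains sets
of many sizes. -/
theorem exists_card_union_eq (hun : ∀ a b, C a → C b → C (a ∪ b)) (f : α → Finset α)
    (D Q X : Finset α) (w : ℕ) (hDQ : Disjoint D Q) (hX : X ⊆ D)
    (hf : ∀ x ∈ Q, C (f x) ∧ x ∈ f x ∧ f x ⊆ insert x D)
    (h1 : (Q.biUnion fun x => (f x ∩ D) \ X).card + 1 ≤ Q.card)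
    (h2 : (Q.biUnion fun x => (f x ∩ D) \ X).card + 1 + X.card ≤ w)
    (h3 : w ≤ Q.card + (Q.biUnion fun x => (f x ∩ D) \ X).card + X.card) :
    ∃ c, C c ∧ (X ∪ c).card = w := by
  obtain ⟨J, hJQ, hJ⟩ := exists_card_add_card_biUnion Q (fun x => (f x ∩ D) \ X) (w - X.card)
    h1 (by omega) (by omega)
  have hJne : J.Nonempty := by
    rw [Finset.nonempty_iff_ne_empty]
    rintro rfl
    simp at hJ
    omega
  refine ⟨J.biUnion f, biUnion_mem_of_union_closed hun f J hJne fun x hx => (hf x (hJQ hx)).1, ?_⟩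
  have hE : J.biUnion (fun x => (f x ∩ D) \ X) ⊆ D \ X := by
    intro y hy
    simp only [Finset.mem_biUnion, Finset.mem_sdiff, Finset.mem_inter] at hy ⊢
    tauto
  have heq : X ∪ J.biUnion f = X ∪ (J ∪ J.biUnion fun x => (f x ∩ D) \ X) := by
    ext y
    simp only [Finset.mem_union, Finset.mem_biUnion, Finset.mem_sdiff, Finset.mem_inter]
    constructor
    · rintro (h | ⟨x, hx, hy⟩)
      · exact Or.inl h
      · by_cases hyX : y ∈ X
        · exact Or.inl hyX
        · rcases Finset.mem_insert.1 ((hf x (hJQ hx)).2.2 hy) with rfl | hyD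
          · exact Or.inr (Or.inl hx)
          · exact Or.inr (Or.inr ⟨x, hx, ⟨hy, hyD⟩, hyX⟩)
    · rintro (h | h | ⟨x, hx, ⟨hy, -⟩, -⟩)
      · exact Or.inl h
      · exact Or.inr ⟨y, h, (hf y (hJQ h)).2.1⟩
      · exact Or.inr ⟨x, hx, hy⟩
  have hDJ : Disjoint D J := Finset.disjoint_of_subset_right hJQ hDQ
  rw [heq, Finset.card_union_of_disjoint, Finset.card_union_of_disjoint, hJ]
  · omega
  · exact Finset.disjoint_of_subset_right (hE.trans Finset.sdiff_subset) hDJ.symm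
  · rw [Finset.disjoint_union_right]
    exact ⟨Finset.disjoint_of_subset_left hX hDJ,
      Finset.disjoint_of_subset_right hE Finset.disjoint_sdiff⟩

variable {P : Finset α} {t w : ℕ}

theorem card_biUnion_inter_sdiff_le (f : α → Finset α) (D Q X : Finset α) (hX : X ⊆ D) :
    (Q.biUnion fun x => (f x ∩ D) \ X).card + X.card ≤ D.card := by
  rw [← Finset.card_sdiff_add_card_eq_card hX]
  refine Nat.add_le_add_right (Finset.card_le_card fun y hy => ?_) _
  simp only [Finset.mem_biUnion, Finset.mem_sdiff, Finset.mem_inter] at hy ⊢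
  tauto

theorem exists_mem_of_insert_not_free {D : Finset α} {x : α} (hD : ∀ c, C c → ¬ c ⊆ D)
    (hx : ∃ c, C c ∧ c ⊆ insert x D) : ∃ c, C c ∧ x ∈ c ∧ c ⊆ insert x D := by
  obtain ⟨c, hc, hcD⟩ := hx
  refine ⟨c, hc, ?_, hcD⟩
  by_contra hxc
  exact hD c hc ((Finset.subset_insert_iff_of_notMem hxc).1 hcD)

theorem exists_free_card_eq (hP : P.card = w + t) (hwt : t + 2 ≤ w)
    (hne : ∀ c, C c → c.Nonempty) (hun : ∀ a b, C a → C b → C (a ∪ b))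
    (hw : ∀ c, C c → c.card ≠ w) :
    ∃ D ⊆ P, D.card = t + 1 ∧ ∀ c, C c → ¬ c ⊆ D := by
  classical
  obtain ⟨D, hD, hmax⟩ := (P.powerset.filter fun D => ∀ c, C c → ¬ c ⊆ D).exists_max_image
    Finset.card ⟨∅, by
      simp only [Finset.mem_filter, Finset.mem_powerset, Finset.empty_subset, true_and,
        Finset.subset_empty]
      exact fun c hc => (hne c hc).ne_empty⟩
  simp only [Finset.mem_filter, Finset.mem_powerset] at hD hmax
  obtain ⟨hDP, hDfree⟩ := hD
  by_cases hDt : t + 1 ≤ D.card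
  · obtain ⟨D', hD', hc⟩ := Finset.exists_subset_card_eq hDt
    exact ⟨D', hD'.trans hDP, hc, fun c hc h => hDfree c hc (h.trans hD')⟩
  have hx : ∀ x ∈ P \ D, ∃ c, C c ∧ x ∈ c ∧ c ⊆ insert x D := by
    intro x hx
    obtain ⟨hxP, hxD⟩ := Finset.mem_sdiff.1 hx
    refine exists_mem_of_insert_not_free hDfree ?_
    by_contra! hcon
    have := hmax (insert x D) ⟨Finset.insert_subset hxP hDP, hcon⟩
    rw [Finset.card_insert_of_notMem hxD] at this
    omega
  choose! f hf using hx
  have h1 := card_biUnion_inter_sdiff_le f D (P \ D) ∅ (by simp)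
  have h2 := Finset.card_sdiff_add_card_eq_card hDP
  rw [Finset.card_empty] at h1
  obtain ⟨c, hc, hcw⟩ := exists_card_union_eq hun f D (P \ D) ∅ w Finset.disjoint_sdiff (by simp)
    hf (by omega) (by simp only [Finset.card_empty]; omega)
    (by simp only [Finset.card_empty]; omega)
  rw [Finset.empty_union] at hcw
  exact absurd hcw (hw c hc)

theorem exists_card_union_eq_of_free (hP : P.card = w + t) (hwt : t + 2 ≤ w)
    (hun : ∀ a b, C a → C b → C (a ∪ b))
    (hcov : ∀ D ⊆ P, D.card = t + 2 → ∃ c, C c ∧ c ⊆ D)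
    {D X : Finset α} (hDP : D ⊆ P) (hD : D.card = t + 1) (hDfree : ∀ c, C c → ¬ c ⊆ D)
    (hX : X ⊆ D) (hXne : X.Nonempty) : ∃ c, C c ∧ (X ∪ c).card = w := by
  have hx : ∀ x ∈ P \ D, ∃ c, C c ∧ x ∈ c ∧ c ⊆ insert x D := by
    intro x hx
    obtain ⟨hxP, hxD⟩ := Finset.mem_sdiff.1 hx
    exact exists_mem_of_insert_not_free hDfree (hcov _ (Finset.insert_subset hxP hDP)
      (by rw [Finset.card_insert_of_notMem hxD, hD]))
  choose! f hf using hx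
  have h1 := card_biUnion_inter_sdiff_le f D (P \ D) X hX
  have h2 := Finset.card_sdiff_add_card_eq_card hDP
  have h3 := hXne.card_pos
  exact exists_card_union_eq hun f D (P \ D) X w Finset.disjoint_sdiff hX
    hf (by omega) (by omega) (by omega)

theorem singleton_mem_or_exists_ne_free (hP : P.card = w + t) (hwt : t + 2 ≤ w)
    (hun : ∀ a b, C a → C b → C (a ∪ b)) (hw : ∀ c, C c → c.card ≠ w)
    {D : Finset α} (hDP : D ⊆ P) (hD : D.card = t + 1) (hDfree : ∀ c, C c → ¬ c ⊆ D) :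
    (∀ x ∈ P \ D, C {x}) ∨ ∃ D' ⊆ P, D'.card = t + 1 ∧ (∀ c, C c → ¬ c ⊆ D') ∧ D' ≠ D := by
  refine or_iff_not_imp_right.2 fun hcon => ?_
  push Not at hcon
  obtain ⟨d, hd⟩ : D.Nonempty := Finset.card_pos.1 (by omega)
  have hx : ∀ x ∈ P \ D, ∃ c, C c ∧ x ∈ c ∧ c ⊆ insert x (D.erase d) := by
    intro x hx
    obtain ⟨hxP, hxD⟩ := Finset.mem_sdiff.1 hx
    refine exists_mem_of_insert_not_free
      (fun c hc h => hDfree c hc (h.trans (Finset.erase_subset _ _))) ?_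
    by_contra! hfree
    have hcon' := hcon (insert x (D.erase d))
      (Finset.insert_subset hxP ((Finset.erase_subset _ _).trans hDP))
      (by rw [Finset.card_insert_of_notMem (fun h => hxD (Finset.mem_of_mem_erase h)),
        Finset.card_erase_of_mem hd]; omega) hfree
    exact hxD (hcon' ▸ Finset.mem_insert_self _ _)
  choose! f hf using hx
  have h1 := card_biUnion_inter_sdiff_le f (D.erase d) (P \ D) ∅ (by simp)
  have h2 := Finset.card_sdiff_add_card_eq_card hDP
  rw [Finset.card_empty, Finset.card_erase_of_mem hd] at h1
  have h3 : ((P \ D).biUnion fun x => (f x ∩ D.erase d) \ ∅).card = 0 := by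
    by_contra h0
    obtain ⟨c, hc, hcw⟩ := exists_card_union_eq hun f (D.erase d) (P \ D) ∅ w
      (Finset.disjoint_of_subset_left (Finset.erase_subset _ _) Finset.disjoint_sdiff) (by simp)
      hf (by omega) (by simp only [Finset.card_empty]; omega)
      (by simp only [Finset.card_empty]; omega)
    rw [Finset.empty_union] at hcw
    exact hw c hc hcw
  intro x hx
  obtain ⟨hC, hxf, hfx⟩ := hf x hx
  convert hC using 1
  refine (Finset.eq_singleton_iff_unique_mem.2 ⟨hxf, fun y hy => ?_⟩).symm
  rcases Finset.mem_insert.1 (hfx hy) with rfl | hyD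
  · rfl
  · rw [Finset.card_eq_zero] at h3
    have : y ∈ (P \ D).biUnion fun x => (f x ∩ D.erase d) \ ∅ := by
      simp only [Finset.mem_biUnion, Finset.sdiff_empty]
      exact ⟨x, hx, Finset.mem_inter.2 ⟨hy, hyD⟩⟩
    exact absurd (h3 ▸ this) (Finset.notMem_empty y)

end UnionClosed

section Types

variable {α : Type*} [DecidableEq α] {s k t : ℕ} {𝓕 𝓗 : Finset (Finset α)} {F F' D D' : Finset α}

theorem IsHomogeneous.exists_sdiff_eq_union (h : IsHomogeneous s 𝓗) (hF : F ∈ 𝓗) (a b : Finset α)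
    (ha : ∃ F' ∈ 𝓗, F' ≠ F ∧ F \ F' = a) (hb : ∃ F' ∈ 𝓗, F' ≠ F ∧ F \ F' = b) :
    ∃ F' ∈ 𝓗, F' ≠ F ∧ F \ F' = a ∪ b := by
  obtain ⟨F₁, hF₁, hne₁, rfl⟩ := ha
  obtain ⟨F₂, hF₂, hne₂, rfl⟩ := hb
  obtain ⟨F₃, hF₃, hne, h3⟩ := h.1 F hF F₁ hF₁ F₂ hF₂ hne₁ hne₂
  refine ⟨F₃, hF₃, hne, ?_⟩
  rw [← Finset.sdiff_inter_self_left, h3]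
  ext x
  simp only [Finset.mem_sdiff, Finset.mem_inter, Finset.mem_union]
  tauto

theorem sdiff_nonempty_of_ne (hk : ∀ F ∈ 𝓗, F.card = k) (hF : F ∈ 𝓗) (hF' : F' ∈ 𝓗)
    (hne : F' ≠ F) : (F \ F').Nonempty := by
  rw [Finset.sdiff_nonempty]
  exact fun h => hne (Finset.eq_of_subset_of_card_le h (by rw [hk F hF, hk F' hF'])).symm

theorem card_sdiff_ne_of_avoiding (hk : ∀ F ∈ 𝓗, F.card = k) (htk : t ≤ k)
    (hav : ∀ A ∈ 𝓗, ∀ B ∈ 𝓗, A ≠ B → (A ∩ B).card ≠ t) (hF : F ∈ 𝓗) (hF' : F' ∈ 𝓗)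
    (hne : F' ≠ F) : (F \ F').card ≠ k - t := by
  have h1 := hav F hF F' hF' hne.symm
  have h2 := Finset.card_sdiff_add_card_inter F F'
  rw [hk F hF] at h2
  omega

theorem IsHomogeneous.exists_isOwn (hk : ∀ F ∈ 𝓗, F.card = k) (htk : 2 * t + 1 < k)
    (hav : ∀ A ∈ 𝓗, ∀ B ∈ 𝓗, A ≠ B → (A ∩ B).card ≠ t) (h : IsHomogeneous s 𝓗) (hF : F ∈ 𝓗) :
    ∃ A, A.card = k - t - 1 ∧ IsOwn 𝓗 F A := by
  obtain ⟨D, hDF, hD, hfree⟩ := exists_free_card_eq (P := F) (t := t) (w := k - t)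
    (C := fun c => ∃ F' ∈ 𝓗, F' ≠ F ∧ F \ F' = c) (by rw [hk F hF]; omega) (by omega)
    (by rintro _ ⟨F', hF', hne, rfl⟩; exact sdiff_nonempty_of_ne hk hF hF' hne)
    (h.exists_sdiff_eq_union hF)
    (by rintro _ ⟨F', hF', hne, rfl⟩; exact card_sdiff_ne_of_avoiding hk (by omega) hav hF hF' hne)
  refine ⟨F \ D, ?_, Finset.sdiff_subset, fun F' hF' hsub => ?_⟩
  · rw [Finset.card_sdiff_of_subset hDF, hk F hF]
    omega
  · by_contra hne
    exact hfree _ ⟨F', hF', hne, rfl⟩ (sdiff_le_comm.1 hsub)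

theorem IsHomogeneous.isCore_or_exists_isOwn (hk : ∀ F ∈ 𝓕, F.card = k) (htk : 2 * t + 1 < k)
    (hav : ∀ A ∈ 𝓕, ∀ B ∈ 𝓕, A ≠ B → (A ∩ B).card ≠ t) (hs : k < s) (hsub : 𝓗 ⊆ 𝓕)
    (h : IsHomogeneous s 𝓗) (hF : F ∈ 𝓗) :
    (∃ D, D.card = t + 1 ∧ IsCore s 𝓕 F D) ∨
    (∃ A A', A ≠ A' ∧ A.card = k - t - 1 ∧ A'.card = k - t - 1 ∧ IsOwn 𝓕 F A ∧ IsOwn 𝓕 F A') ∨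
    ∃ B, B.card = k - t - 2 ∧ IsOwn 𝓗 F B := by
  set C : Finset α → Prop := fun c => ∃ F' ∈ 𝓗, F' ≠ F ∧ F \ F' = c
  have hk' : ∀ F ∈ 𝓗, F.card = k := fun F hF => hk F (hsub hF)
  have hP : F.card = (k - t) + t := by rw [hk' F hF]; omega
  have hwt : t + 2 ≤ k - t := by omega
  have hun : ∀ a b, C a → C b → C (a ∪ b) := h.exists_sdiff_eq_union hF
  have hne : ∀ c, C c → c.Nonempty := by
    rintro _ ⟨F', hF', hne, rfl⟩
    exact sdiff_nonempty_of_ne hk' hF hF' hne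
  have hav' : ∀ A ∈ 𝓗, ∀ B ∈ 𝓗, A ≠ B → (A ∩ B).card ≠ t :=
    fun A hA B hB => hav A (hsub hA) B (hsub hB)
  have hw : ∀ c, C c → c.card ≠ k - t := by
    rintro _ ⟨F', hF', hne, rfl⟩
    exact card_sdiff_ne_of_avoiding hk' (by omega) hav' hF hF' hne
  by_cases hcov : ∀ D ⊆ F, D.card = t + 2 → ∃ c, C c ∧ c ⊆ D
  swap
  · push Not at hcov
    obtain ⟨D, hDF, hD, hfree⟩ := hcov
    refine Or.inr (Or.inr ⟨F \ D, ?_, Finset.sdiff_subset, fun F' hF' hsub => ?_⟩)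
    · rw [Finset.card_sdiff_of_subset hDF, hk' F hF]
      omega
    · by_contra hne
      exact hfree _ ⟨F', hF', hne, rfl⟩ (sdiff_le_comm.1 hsub)
  have hown : ∀ D ⊆ F, D.card = t + 1 → (∀ c, C c → ¬ c ⊆ D) → IsOwn 𝓕 F (F \ D) := by
    refine fun D hDF hD hfree => ⟨Finset.sdiff_subset, fun F' hF' hsubF => ?_⟩
    by_contra hneF
    obtain ⟨c, ⟨F₂, hF₂, hne₂, rfl⟩, hcard⟩ := exists_card_union_eq_of_free hP hwt hun hcov hDF hD
      hfree (sdiff_le_comm.1 hsubF) (sdiff_nonempty_of_ne hk (hsub hF) hF' hneF)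
    refine ((h.2 F hF F₂ hF₂ hne₂.symm).mono hsub).card_inter_mem_ne hk (t := t) (by omega) hs hav
      hF' ?_
    have h1 : F \ F' ∪ F \ F₂ = F \ (F ∩ F₂ ∩ F') := by
      ext x
      simp only [Finset.mem_sdiff, Finset.mem_inter, Finset.mem_union]
      tauto
    have h2 : F ∩ F₂ ∩ F' ⊆ F := Finset.inter_subset_left.trans Finset.inter_subset_left
    have h3 := Finset.card_le_card h2
    rw [h1, Finset.card_sdiff_of_subset h2, hk' F hF] at hcard
    rw [hk' F hF] at h3
    omega
  obtain ⟨D, hDF, hD, hfree⟩ := exists_free_card_eq hP hwt hne hun hw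
  rcases singleton_mem_or_exists_ne_free hP hwt hun hw hDF hD hfree with
    hall | ⟨D', hDF', hD', hfree', hneD⟩
  · refine Or.inl ⟨D, hD, hDF, fun Y hY => ?_⟩
    obtain ⟨F', hF', hneF, hFF⟩ : C ((F \ D) \ Y) := by
      have := biUnion_mem_of_union_closed hun (fun x : α => {x}) ((F \ D) \ Y)
        (Finset.sdiff_nonempty.2 hY.2) (fun x hx => hall x (Finset.mem_sdiff.1 hx).1)
      rwa [Finset.biUnion_singleton_eq_self] at this
    convert (h.2 F hF F' hF' hneF.symm).mono hsub using 1
    rw [← Finset.sdiff_sdiff_self_left, hFF]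
    ext x
    have h1 : x ∈ D → x ∈ F := fun hx => hDF hx
    have h2 : x ∈ Y → x ∈ F \ D := fun hx => hY.1 hx
    simp only [Finset.mem_sdiff, Finset.mem_union] at h2 ⊢
    tauto
  · refine Or.inr (Or.inl ⟨F \ D, F \ D', ?_, ?_, ?_, hown D hDF hD hfree,
      hown D' hDF' hD' hfree'⟩)
    · intro heq
      apply hneD
      rw [← Finset.sdiff_sdiff_eq_self hDF, heq, Finset.sdiff_sdiff_eq_self hDF']
    · rw [Finset.card_sdiff_of_subset hDF, hk' F hF]
      omega
    · rw [Finset.card_sdiff_of_subset hDF', hk' F hF]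
      omega

theorem IsCore.isOwn (hk : ∀ F ∈ 𝓕, F.card = k) (htk : t < k) (hs : k < s)
    (hav : ∀ A ∈ 𝓕, ∀ B ∈ 𝓕, A ≠ B → (A ∩ B).card ≠ t) (hF : F ∈ 𝓕)
    (hD : D.card = t + 1) (h : IsCore s 𝓕 F D) (hDk : 2 * t + 1 < k) : IsOwn 𝓕 F (F \ D) := by
  refine ⟨Finset.sdiff_subset, fun F' hF' hsub => ?_⟩
  by_contra hne
  have hlt : (D ∩ F').card < D.card := by
    refine Finset.card_lt_card ⟨Finset.inter_subset_left, fun hsubD => hne ?_⟩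
    refine (Finset.eq_of_subset_of_card_le (fun x hx => ?_) (by rw [hk F hF, hk F' hF'])).symm
    by_cases hxD : x ∈ D
    · exact (Finset.mem_inter.1 (hsubD hxD)).2
    · exact hsub (Finset.mem_sdiff.2 ⟨hx, hxD⟩)
  have hcard : (F \ D).card = k - (t + 1) := by
    rw [Finset.card_sdiff_of_subset h.1, hk F hF, hD]
  obtain ⟨Y, hY, hYc⟩ := Finset.exists_subset_card_eq (s := F \ D) (n := t - (D ∩ F').card)
    (by omega)
  refine (h.2 Y ⟨hY, fun h' => ?_⟩).card_inter_mem_ne hk htk hs hav hF' ?_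
  · have := Finset.card_le_card h'
    omega
  · have h1 : (D ∪ Y) ∩ F' = D ∩ F' ∪ Y := by
      rw [Finset.union_inter_distrib_right, Finset.inter_eq_left.2 (hY.trans hsub)]
    rw [h1, Finset.card_union_of_disjoint, hYc]
    · omega
    · exact Finset.disjoint_of_subset_left Finset.inter_subset_left
        (Finset.disjoint_of_subset_right hY Finset.disjoint_sdiff)

theorem IsCore.card_inter_sdiff_lt (hk : ∀ F ∈ 𝓕, F.card = k) (hs : k < s)
    (hav : ∀ A ∈ 𝓕, ∀ B ∈ 𝓕, A ≠ B → (A ∩ B).card ≠ t) (hDk : 2 * t + 1 < k)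
    (hD : D.card = t + 1) (hD' : D'.card = t + 1) (hne : D ≠ D')
    (h : IsCore s 𝓕 F D) (h' : IsCore s 𝓕 F' D') (Y : Finset α) (hY : Y.card = k - t - 2)
    (hYF : Y ⊂ F \ D) (hYF' : Y ⊂ F' \ D') : False := by
  have hlt : (D ∩ D').card < t + 1 := by
    rw [← hD]
    refine Finset.card_lt_card ⟨Finset.inter_subset_left, fun hsub => hne ?_⟩
    exact Finset.eq_of_subset_of_card_le (fun x hx => (Finset.mem_inter.1 (hsub hx)).2) (by omega)
  obtain ⟨Z, hZ, hZc⟩ := Finset.exists_subset_card_eq (s := Y) (n := t - (D ∩ D').card) (by omega)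
  refine (h.2 Z (hZ.trans_ssubset hYF)).card_inter_ne hk (by omega) hs hav (h'.2 Y hYF') ?_
  have h1 : (D ∪ Z) ∩ (D' ∪ Y) = D ∩ D' ∪ Z := by
    ext x
    have h2 : x ∈ Z → x ∈ Y := fun hx => hZ hx
    have h3 : x ∈ Y → x ∈ F \ D := fun hx => hYF.1 hx
    have h4 : x ∈ Y → x ∈ F' \ D' := fun hx => hYF'.1 hx
    simp only [Finset.mem_sdiff, Finset.mem_union, Finset.mem_inter] at h3 h4 ⊢
    tauto
  rw [h1, Finset.card_union_of_disjoint, hZc]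
  · omega
  · exact Finset.disjoint_of_subset_left Finset.inter_subset_left
      (Finset.disjoint_of_subset_right (hZ.trans hYF.1) Finset.disjoint_sdiff)

end Types

/-- The elements of `F` whose colour lies in `A`. -/
def colorPart {α ι : Type*} [DecidableEq ι] (χ : α → ι) (A : Finset ι) (F : Finset α) : Finset α :=
  F.filter fun x => χ x ∈ A

/-- Every member of `𝓕` contains exactly one element of every colour. -/
def IsRainbow {α ι : Type*} [Fintype ι] (χ : α → ι) (𝓕 : Finset (Finset α)) : Prop :=
  ∀ F ∈ 𝓕, F.card = Fintype.card ι ∧ Set.InjOn χ F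

section Coloring

variable {α ι : Type*} {χ : α → ι} {A : Finset ι} {F F' : Finset α} {𝓕 𝓢 : Finset (Finset α)}
  {s : ℕ}

theorem IsRainbow.mono [Fintype ι] (h : IsRainbow χ 𝓕) (hsub : 𝓢 ⊆ 𝓕) : IsRainbow χ 𝓢 :=
  fun F hF => h F (hsub hF)

variable [DecidableEq ι]

theorem colorPart_subset : colorPart χ A F ⊆ F := Finset.filter_subset _ _

theorem colorPart_image_of_subset (hF : Set.InjOn χ F) (h : F' ⊆ F) :
    colorPart χ (F'.image χ) F = F' := by
  ext x
  simp only [colorPart, Finset.mem_filter, Finset.mem_image]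
  constructor
  · rintro ⟨hx, y, hy, hyx⟩
    exact hF (h hy) hx hyx ▸ hy
  · exact fun hx => ⟨h hx, x, hx, rfl⟩

variable [Fintype ι]

theorem IsRainbow.image_colorPart (h : IsRainbow χ 𝓕) (hF : F ∈ 𝓕) :
    (colorPart χ A F).image χ = A := by
  have huniv : F.image χ = Finset.univ := by
    rw [← Finset.card_eq_iff_eq_univ, Finset.card_image_of_injOn (h F hF).2, (h F hF).1]
  ext i
  simp only [colorPart, Finset.mem_filter, Finset.mem_image]
  constructor
  · rintro ⟨x, ⟨-, hx⟩, rfl⟩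
    exact hx
  · intro hi
    obtain ⟨x, hx, rfl⟩ := Finset.mem_image.1 (huniv ▸ Finset.mem_univ i)
    exact ⟨x, ⟨hx, hi⟩, rfl⟩

theorem IsRainbow.colorPart_eq_of_subset (h : IsRainbow χ 𝓕) (hF : F ∈ 𝓕) (hF' : F' ∈ 𝓕)
    (hsub : colorPart χ A F ⊆ F') : colorPart χ A F' = colorPart χ A F := by
  conv_lhs => rw [← h.image_colorPart (A := A) hF]
  exact colorPart_image_of_subset (h F' hF').2 hsub

variable [DecidableEq α]

theorem IsRainbow.sdiff_colorPart_nonempty (h : IsRainbow χ 𝓕) (hF : F ∈ 𝓕) (hA : A ≠ Finset.univ) :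
    (F \ colorPart χ A F).Nonempty := by
  rw [Finset.sdiff_nonempty]
  intro hsub
  have heq := Finset.Subset.antisymm hsub colorPart_subset
  apply hA
  have h1 := h.image_colorPart (A := A) hF
  rw [← heq] at h1
  rw [← h1, ← Finset.card_eq_iff_eq_univ, Finset.card_image_of_injOn (h F hF).2, (h F hF).1]

theorem isHomogeneous_of_stable (h : IsRainbow χ 𝓢) (hs : Fintype.card ι < s)
    (𝒬 : Finset (Finset ι))
    (hforb : ∀ A ∈ 𝒬, ∀ F ∈ 𝓢, ∀ F' ∈ 𝓢, F ≠ F' → (F ∩ F').image χ ≠ A)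
    (hst : ∀ A ∉ 𝒬, A ≠ Finset.univ → ∀ F ∈ 𝓢, IsKernel s 𝓢 (colorPart χ A F)) :
    IsHomogeneous s 𝓢 := by
  have hcard : ∀ F ∈ 𝓢, F.card = Fintype.card ι := fun F hF => (h F hF).1
  have hlt : ∀ F ∈ 𝓢, ∀ F' ∈ 𝓢, F ≠ F' → (F ∩ F').card < Fintype.card ι := by
    intro F hF F' hF' hne
    rw [← hcard F hF]
    refine Finset.card_lt_card ⟨Finset.inter_subset_left, fun hsub => hne ?_⟩
    exact Finset.eq_of_subset_of_card_le (hsub.trans Finset.inter_subset_right)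
      (by rw [hcard F hF, hcard F' hF'])
  have hker : ∀ F ∈ 𝓢, ∀ G ∈ 𝓢, ∀ G' ∈ 𝓢, G ≠ G' → G ∩ G' ⊆ F → IsKernel s 𝓢 (G ∩ G') := by
    intro F hF G hG G' hG' hne hsub
    rw [← colorPart_image_of_subset (h F hF).2 hsub]
    refine hst _ (fun hQ => hforb _ hQ G hG G' hG' hne rfl) (fun huniv => ?_) F hF
    have h1 := hlt G hG G' hG' hne
    have h2 := Finset.card_image_le (s := G ∩ G') (f := χ)
    rw [huniv, Finset.card_univ] at h2
    omega
  refine ⟨?_, fun F hF F' hF' hne => hker F hF F hF F' hF' hne Finset.inter_subset_left⟩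
  intro F hF F₁ hF₁ F₂ hF₂ hne₁ hne₂
  have hk₁ := hker F hF F hF F₁ hF₁ hne₁.symm Finset.inter_subset_left
  have hk₂ := hker F hF F hF F₂ hF₂ hne₂.symm Finset.inter_subset_left
  obtain ⟨G, hG, G', hG', -, -, hGG⟩ := hk₁.exists_inter_eq_inter hcard hs hk₂
  have h3 : F ∩ F₁ ∩ (F ∩ F₂) = F ∩ F₁ ∩ F₂ := by
    ext x
    simp only [Finset.mem_inter]
    tauto
  rw [h3] at hGG
  have hsub : F ∩ F₁ ∩ F₂ ⊆ F := Finset.inter_subset_left.trans Finset.inter_subset_left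
  have h4 : (F ∩ F₁ ∩ F₂).card < Fintype.card ι :=
    (Finset.card_le_card Finset.inter_subset_left).trans_lt (hlt F hF F₁ hF₁ hne₁.symm)
  have hGne : G ≠ G' := by
    rintro rfl
    rw [Finset.inter_self] at hGG
    rw [← hGG, hcard G hG] at h4
    omega
  obtain ⟨F₃, hF₃, -, hF₃F⟩ := (hker F hF G hG G' hG' hGne (hGG ▸ hsub)).exists_inter_eq F
    (by rwa [hcard F hF])
  rw [hGG, Finset.inter_eq_left.2 hsub, Finset.inter_comm] at hF₃F
  refine ⟨F₃, hF₃, ?_, hF₃F⟩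
  rintro rfl
  rw [Finset.inter_self] at hF₃F
  rw [← hF₃F, hcard _ hF₃] at h4
  omega

theorem exists_stable_partition (𝒬 : Finset (Finset ι)) (m : ℕ) :
    ∀ 𝓕 : Finset (Finset α), 𝓕.card = m → IsRainbow χ 𝓕 →
    ∃ 𝓢 ⊆ 𝓕, ∃ R : Finset ι → Finset (Finset α),
      (∀ A ∉ 𝒬, A ≠ Finset.univ → ∀ F ∈ 𝓢, IsKernel s 𝓢 (colorPart χ A F)) ∧
      (∀ A, R A ⊆ 𝓕) ∧ (∀ A, (R A).Nonempty → A ∉ 𝒬 ∧ A ≠ Finset.univ) ∧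
      (∀ A, ∀ F ∈ R A, ¬ IsKernel s (R A) (colorPart χ A F)) ∧
      𝓕.card ≤ 𝓢.card + ∑ A, (R A).card := by
  classical
  induction m with
  | zero =>
    intro 𝓕 h𝓕 _
    refine ⟨∅, by simp, fun _ => ∅, ?_⟩
    simp [h𝓕]
  | succ m ih =>
    intro 𝓕 h𝓕 hrb
    by_cases hst : ∀ A ∉ 𝒬, A ≠ Finset.univ → ∀ F ∈ 𝓕, IsKernel s 𝓕 (colorPart χ A F)
    · exact ⟨𝓕, subset_rfl, fun _ => ∅, hst, by simp⟩
    push Not at hst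
    obtain ⟨A₀, hA₀, hA₀u, F₀, hF₀, hF₀k⟩ := hst
    obtain ⟨𝓢, h𝓢, R, h1, h2, h3, h4, h5⟩ := ih (𝓕.erase F₀)
      (by rw [Finset.card_erase_of_mem hF₀]; omega) (hrb.mono (Finset.erase_subset _ _))
    have hins : insert F₀ (R A₀) ⊆ 𝓕 :=
      Finset.insert_subset hF₀ ((h2 A₀).trans (Finset.erase_subset _ _))
    refine ⟨𝓢, h𝓢.trans (Finset.erase_subset _ _), Function.update R A₀ (insert F₀ (R A₀)), h1,
      fun A => ?_, fun A hA => ?_, fun A => ?_, ?_⟩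
    · rcases eq_or_ne A A₀ with rfl | hA
      · simpa using hins
      · simpa [hA] using (h2 A).trans (Finset.erase_subset _ _)
    · rcases eq_or_ne A A₀ with rfl | hne
      · exact ⟨hA₀, hA₀u⟩
      · exact h3 A (by simpa [hne] using hA)
    · rcases eq_or_ne A A₀ with rfl | hne
      swap
      · simpa [hne] using h4 A
      rw [Function.update_self]
      intro F hF hker
      have hF𝓕 := hins hF
      have hneF : colorPart χ A F ≠ colorPart χ A F₀ := fun heq => hF₀k (heq ▸ hker.mono hins)
      have hFR : F ∈ R A := by
        rcases Finset.mem_insert.1 hF with rfl | hF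
        · exact absurd rfl hneF
        · exact hF
      obtain ⟨𝓟, h𝓟, hs, hsub, hint⟩ := hker
      refine h4 A F hFR ⟨𝓟, fun F' hF' => ?_, hs, hsub, hint⟩
      rcases Finset.mem_insert.1 (h𝓟 hF') with rfl | h'
      · exact absurd (hrb.colorPart_eq_of_subset hF𝓕 hF₀ (hsub _ hF')).symm hneF
      · exact h'
    · have hF₀R : F₀ ∉ R A₀ := fun h => Finset.notMem_erase F₀ 𝓕 (h2 A₀ h)
      have h6 : ∑ A, (Function.update R A₀ (insert F₀ (R A₀)) A).card =
          ∑ A, (R A).card + 1 := by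
        rw [← Finset.add_sum_erase _ _ (Finset.mem_univ A₀),
          ← Finset.add_sum_erase _ (fun A => (R A).card) (Finset.mem_univ A₀),
          Function.update_self, Finset.card_insert_of_notMem hF₀R]
        have : ∀ A ∈ Finset.univ.erase A₀,
            (Function.update R A₀ (insert F₀ (R A₀)) A).card = (R A).card := by
          intro A hA
          rw [Function.update_of_ne (Finset.ne_of_mem_erase hA)]
        rw [Finset.sum_congr rfl this]
        omega
      rw [Finset.card_erase_of_mem hF₀] at h5
      omega

theorem exists_popular_of_not_isKernel (Y : Finset α) (k : ℕ) (hk : ∀ F ∈ 𝓕, F.card = k)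
    (hne : 𝓕.Nonempty) (hY : ∀ F ∈ 𝓕, Y ⊆ F ∧ (F \ Y).Nonempty)
    (hker : ¬ IsKernel s 𝓕 Y) :
    ∃ v, v ∉ Y ∧ 𝓕.card ≤ s * k * (𝓕.filter fun F => v ∈ F).card := by
  classical
  obtain ⟨𝓟, h𝓟, hmax⟩ := (𝓕.powerset.filter fun 𝓟 => ∀ F ∈ 𝓟, ∀ F' ∈ 𝓟, F ≠ F' →
    F ∩ F' = Y).exists_max_image Finset.card ⟨∅, by simp⟩
  simp only [Finset.mem_filter, Finset.mem_powerset] at h𝓟 hmax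
  obtain ⟨h𝓟𝓕, hint⟩ := h𝓟
  have hs : 𝓟.card < s := by
    by_contra! hs
    exact hker ⟨𝓟, h𝓟𝓕, hs, fun F hF => (hY F (h𝓟𝓕 hF)).1, hint⟩
  set T := 𝓟.biUnion fun F => F \ Y
  have hTc : T.card ≤ s * k := by
    refine Finset.card_biUnion_le.trans ((Finset.sum_le_card_nsmul _ _ k fun F hF => ?_).trans ?_)
    · exact (Finset.card_le_card Finset.sdiff_subset).trans (hk F (h𝓟𝓕 hF)).le
    · exact Nat.mul_le_mul_right _ hs.le
  have hhit : ∀ F ∈ 𝓕, ∃ v ∈ T, v ∈ F := by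
    intro F hF
    by_cases hF𝓟 : F ∈ 𝓟
    · obtain ⟨v, hv⟩ := (hY F hF).2
      exact ⟨v, Finset.mem_biUnion.2 ⟨F, hF𝓟, hv⟩, (Finset.mem_sdiff.1 hv).1⟩
    · by_contra! hcon
      have hFY : ∀ F' ∈ 𝓟, F ∩ F' = Y := by
        intro F' hF'
        refine Finset.Subset.antisymm (fun x hx => ?_)
          (Finset.subset_inter (hY F hF).1 (hY F' (h𝓟𝓕 hF')).1)
        obtain ⟨hxF, hxF'⟩ := Finset.mem_inter.1 hx
        by_contra hxY
        exact hcon x (Finset.mem_biUnion.2 ⟨F', hF', Finset.mem_sdiff.2 ⟨hxF', hxY⟩⟩) hxF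
      have := hmax (insert F 𝓟) ⟨Finset.insert_subset hF h𝓟𝓕, ?_⟩
      · rw [Finset.card_insert_of_notMem hF𝓟] at this
        omega
      · intro F₁ h₁ F₂ h₂ hne
        rcases Finset.mem_insert.1 h₁ with rfl | h₁' <;>
          rcases Finset.mem_insert.1 h₂ with rfl | h₂'
        · exact absurd rfl hne
        · exact hFY F₂ h₂'
        · rw [Finset.inter_comm]
          exact hFY F₁ h₁'
        · exact hint F₁ h₁' F₂ h₂' hne
  obtain ⟨F, hF⟩ := hne
  obtain ⟨v₀, hv₀, -⟩ := hhit F hF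
  obtain ⟨v, hv, hvmax⟩ := T.exists_max_image (fun v => (𝓕.filter fun F => v ∈ F).card) ⟨v₀, hv₀⟩
  refine ⟨v, ?_, ?_⟩
  · obtain ⟨F', -, hv'⟩ := Finset.mem_biUnion.1 hv
    exact (Finset.mem_sdiff.1 hv').2
  · calc 𝓕.card ≤ (T.biUnion fun v => 𝓕.filter fun F => v ∈ F).card := by
          refine Finset.card_le_card fun F hF => ?_
          obtain ⟨v, hv, hvF⟩ := hhit F hF
          exact Finset.mem_biUnion.2 ⟨v, hv, Finset.mem_filter.2 ⟨hF, hvF⟩⟩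
      _ ≤ T.card * (𝓕.filter fun F => v ∈ F).card :=
          Finset.card_biUnion_le_card_mul _ _ _ hvmax
      _ ≤ s * k * (𝓕.filter fun F => v ∈ F).card := Nat.mul_le_mul_right _ hTc

end Coloring

section Homogenization

variable {α ι : Type*} [DecidableEq α] [Fintype ι] [DecidableEq ι] {χ : α → ι} {A : Finset ι}
  {𝓕 : Finset (Finset α)} {s : ℕ}

theorem IsRainbow.exists_forbidding (h : IsRainbow χ 𝓕) (hA : A ≠ Finset.univ)
    (hker : ∀ F ∈ 𝓕, ¬ IsKernel s 𝓕 (colorPart χ A F)) :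
    ∃ 𝓡 ⊆ 𝓕, 𝓕.card ≤ s * Fintype.card ι * 𝓡.card ∧
      ∀ F ∈ 𝓡, ∀ F' ∈ 𝓡, F ≠ F' → (F ∩ F').image χ ≠ A := by
  classical
  have hv : ∀ Y ∈ 𝓕.image (colorPart χ A), ∃ v, v ∉ Y ∧
      (𝓕.filter fun F => colorPart χ A F = Y).card ≤ s * Fintype.card ι *
        ((𝓕.filter fun F => colorPart χ A F = Y).filter fun F => v ∈ F).card := by
    intro Y hY
    obtain ⟨F, hF, rfl⟩ := Finset.mem_image.1 hY
    refine exists_popular_of_not_isKernel _ _ (fun F' hF' => (h F' (Finset.mem_filter.1 hF').1).1)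
      ⟨F, by simp [hF]⟩ (fun F' hF' => ?_) fun hk => hker F hF (hk.mono (Finset.filter_subset _ _))
    obtain ⟨hF'𝓕, heq⟩ := Finset.mem_filter.1 hF'
    rw [← heq]
    exact ⟨colorPart_subset, h.sdiff_colorPart_nonempty hF'𝓕 hA⟩
  rcases 𝓕.eq_empty_or_nonempty with rfl | hne
  · exact ⟨∅, by simp, by simp, by simp⟩
  have hα : Nonempty α := by
    obtain ⟨F, hF⟩ := hne
    exact ⟨(hv _ (Finset.mem_image_of_mem _ hF)).choose⟩
  choose! v hvY hvc using hv
  refine ⟨𝓕.filter fun F => v (colorPart χ A F) ∈ F, Finset.filter_subset _ _, ?_, ?_⟩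
  · rw [Finset.card_eq_sum_card_image (colorPart χ A) 𝓕,
      Finset.card_eq_sum_card_fiberwise (t := 𝓕.image (colorPart χ A)) (f := colorPart χ A)
        (fun F hF => Finset.mem_image_of_mem _ (Finset.mem_filter.1 hF).1), Finset.mul_sum]
    refine Finset.sum_le_sum fun Y hY => (hvc Y hY).trans (Nat.mul_le_mul_left _ ?_)
    refine Finset.card_le_card fun F hF => ?_
    simp only [Finset.mem_filter] at hF ⊢
    obtain ⟨⟨hF, rfl⟩, hvF⟩ := hF
    exact ⟨⟨hF, hvF⟩, rfl⟩
  · intro F hF F' hF' hne hAeq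
    obtain ⟨hF, hvF⟩ := Finset.mem_filter.1 hF
    obtain ⟨hF', hvF'⟩ := Finset.mem_filter.1 hF'
    have h1 : colorPart χ A F = F ∩ F' := by
      rw [← hAeq]
      exact colorPart_image_of_subset (h F hF).2 Finset.inter_subset_left
    have h2 : colorPart χ A F' = F ∩ F' := by
      rw [← hAeq]
      exact colorPart_image_of_subset (h F' hF').2 Finset.inter_subset_right
    have h3 := hvY _ (Finset.mem_image_of_mem (colorPart χ A) hF)
    rw [h1] at h3 hvF
    rw [h2] at hvF'
    exact h3 (Finset.mem_inter.2 ⟨hvF, hvF'⟩)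

theorem IsRainbow.exists_isHomogeneous_aux (hs : Fintype.card ι < s) (L : ℕ)
    (hL : L = (Fintype.card (Finset ι) + 1) * (s * Fintype.card ι + 1)) (m : ℕ) :
    ∀ (𝒬 : Finset (Finset ι)) (𝓕 : Finset (Finset α)), 𝒬ᶜ.card = m → IsRainbow χ 𝓕 →
      (∀ A ∈ 𝒬, ∀ F ∈ 𝓕, ∀ F' ∈ 𝓕, F ≠ F' → (F ∩ F').image χ ≠ A) →
      ∃ 𝓗 ⊆ 𝓕, 𝓕.card ≤ L ^ (m + 1) * 𝓗.card ∧ IsHomogeneous s 𝓗 := by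
  classical
  have hL1 : Fintype.card (Finset ι) + 1 ≤ L := by
    rw [hL]
    exact Nat.le_mul_of_pos_right _ (by omega)
  induction m using Nat.strong_induction_on with
  | _ m ih =>
  intro 𝒬 𝓕 hm hrb hforb
  have hpow : L ≤ L ^ (m + 1) := Nat.le_self_pow (by omega) L
  obtain ⟨𝓢, h𝓢, R, h1, h2, h3, h4, h5⟩ := exists_stable_partition (s := s) 𝒬 _ 𝓕 rfl hrb
  by_cases hbig : 𝓕.card ≤ L * 𝓢.card
  · exact ⟨𝓢, h𝓢, hbig.trans (Nat.mul_le_mul_right _ hpow),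
      isHomogeneous_of_stable (hrb.mono h𝓢) hs 𝒬
      (fun A hA F hF F' hF' => hforb A hA F (h𝓢 hF) F' (h𝓢 hF')) h1⟩
  have hA : ∃ A, 𝓕.card ≤ (Fintype.card (Finset ι) + 1) * (R A).card ∧ (R A).Nonempty := by
    by_contra! hcon
    have hR : ∀ A, (Fintype.card (Finset ι) + 1) * (R A).card ≤ 𝓕.card := by
      intro A
      by_contra! hlt
      have := hcon A hlt.le
      simp [this] at hlt
    have hsum : ∑ A, (Fintype.card (Finset ι) + 1) * (R A).card ≤
        Fintype.card (Finset ι) * 𝓕.card := by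
      refine (Finset.sum_le_card_nsmul Finset.univ _ 𝓕.card fun A _ => hR A).trans ?_
      simp
    rw [← Finset.mul_sum] at hsum
    have h6 : (Fintype.card (Finset ι) + 1) * 𝓢.card ≤ L * 𝓢.card := Nat.mul_le_mul_right _ hL1
    have h7 := Nat.mul_le_mul_left (Fintype.card (Finset ι) + 1) h5
    nlinarith
  obtain ⟨A, hAc, hAne⟩ := hA
  obtain ⟨hAQ, hAu⟩ := h3 A hAne
  obtain ⟨𝓡, h𝓡, h𝓡c, h𝓡f⟩ := (hrb.mono (h2 A)).exists_forbidding hAu (h4 A)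
  have hcompl : (insert A 𝒬)ᶜ.card + 1 = m := by
    rw [← hm, Finset.compl_insert]
    exact Finset.card_erase_add_one (by simpa using hAQ)
  obtain ⟨𝓗, h𝓗, h𝓗c, hhom⟩ := ih _ (by omega) (insert A 𝒬) 𝓡 rfl
    (hrb.mono (h𝓡.trans (h2 A))) (by
      intro B hB F hF F' hF'
      rcases Finset.mem_insert.1 hB with rfl | hB
      · exact h𝓡f F hF F' hF'
      · exact hforb B hB F (h2 A (h𝓡 hF)) F' (h2 A (h𝓡 hF')))
  refine ⟨𝓗, h𝓗.trans (h𝓡.trans (h2 A)), ?_, hhom⟩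
  rw [hcompl] at h𝓗c
  calc 𝓕.card ≤ (Fintype.card (Finset ι) + 1) * (R A).card := hAc
    _ ≤ (Fintype.card (Finset ι) + 1) * ((s * Fintype.card ι + 1) * 𝓡.card) :=
        Nat.mul_le_mul_left _ (h𝓡c.trans (Nat.mul_le_mul_right _ (by omega)))
    _ = L * 𝓡.card := by rw [hL]; ring
    _ ≤ L * (L ^ m * 𝓗.card) := Nat.mul_le_mul_left _ h𝓗c
    _ = L ^ (m + 1) * 𝓗.card := by ring

theorem card_fun_le_mul_card_injOn [Fintype α] (F : Finset α) (hF : F.card = Fintype.card ι) :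
    Fintype.card (α → ι) ≤ Fintype.card ι ^ Fintype.card ι *
      (Finset.univ.filter fun χ : α → ι => Set.InjOn χ F).card := by
  classical
  have e : F ≃ ι := Fintype.equivOfCardEq (by simpa using hF)
  set g : (α → ι) → (α → ι) := fun χ x => if h : x ∈ F then e ⟨x, h⟩ else χ x with hg
  have hinj : ∀ χ, Set.InjOn (g χ) F := by
    intro χ x hx y hy hxy
    rw [Finset.mem_coe] at hx hy
    simp only [hg, hx, hy, dif_pos, e.injective.eq_iff] at hxy
    exact congrArg Subtype.val hxy
  have h1 : Fintype.card ι ^ Fintype.card ι = (Finset.univ : Finset (F → ι)).card := by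
    rw [Finset.card_univ, Fintype.card_fun, Fintype.card_coe, hF]
  rw [h1, ← Finset.card_product, ← Finset.card_univ]
  refine Finset.card_le_card_of_injOn (fun χ => (fun x : F => χ x, g χ)) ?_ ?_
  · intro χ _
    simp [hinj χ]
  · intro χ _ χ' _ heq
    simp only [Prod.mk.injEq] at heq
    ext x
    by_cases hx : x ∈ F
    · exact congrFun heq.1 ⟨x, hx⟩
    · have := congrFun heq.2 x
      simpa [hg, hx] using this

theorem exists_isRainbow [Fintype α] (hk : ∀ F ∈ 𝓕, F.card = Fintype.card ι) [Nonempty ι] :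
    ∃ χ : α → ι, ∃ 𝓡 ⊆ 𝓕, IsRainbow χ 𝓡 ∧
      𝓕.card ≤ Fintype.card ι ^ Fintype.card ι * 𝓡.card := by
  classical
  suffices h : ∃ χ : α → ι, 𝓕.card ≤ Fintype.card ι ^ Fintype.card ι *
      (𝓕.filter fun F : Finset α => Set.InjOn χ F).card by
    obtain ⟨χ, hχ⟩ := h
    refine ⟨χ, _, Finset.filter_subset _ _, fun F hF => ?_, hχ⟩
    obtain ⟨hF, hinj⟩ := Finset.mem_filter.1 hF
    exact ⟨hk F hF, hinj⟩
  by_contra! hcon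
  have h1 := Finset.sum_lt_sum_of_nonempty (Finset.univ_nonempty (α := α → ι))
    fun χ _ => hcon χ
  have h2 := Finset.sum_le_sum fun F hF => card_fun_le_mul_card_injOn (ι := ι) F (hk F hF)
  rw [← Finset.mul_sum] at h1 h2
  have h3 := Finset.sum_card_bipartiteAbove_eq_sum_card_bipartiteBelow (s := 𝓕)
    (t := (Finset.univ : Finset (α → ι))) (fun (F : Finset α) χ => Set.InjOn χ F)
  simp only [Finset.bipartiteAbove, Finset.bipartiteBelow] at h3
  rw [h3] at h2
  simp only [Finset.sum_const, smul_eq_mul, Finset.card_univ] at h1 h2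
  rw [mul_comm] at h2
  omega

/-- Füredi's theorem: every `k`-uniform family contains a homogeneous subfamily of positive
proportion. -/
theorem exists_isHomogeneous (k s : ℕ) (hk : 0 < k) (hs : k < s) :
    ∃ K, ∀ (n : ℕ) (𝓕 : Finset (Finset (Fin n))), (∀ F ∈ 𝓕, F.card = k) →
      ∃ 𝓗 ⊆ 𝓕, 𝓕.card ≤ K * 𝓗.card ∧ IsHomogeneous s 𝓗 := by
  have : Nonempty (Fin k) := ⟨⟨0, hk⟩⟩
  refine ⟨k ^ k * ((Fintype.card (Finset (Fin k)) + 1) * (s * Fintype.card (Fin k) + 1)) ^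
    (((∅ : Finset (Finset (Fin k)))ᶜ).card + 1), fun n 𝓕 h𝓕 => ?_⟩
  obtain ⟨χ, 𝓡, h𝓡, hrb, hc⟩ := exists_isRainbow (ι := Fin k) (𝓕 := 𝓕) (by simpa using h𝓕)
  obtain ⟨𝓗, h𝓗, hHc, hhom⟩ := hrb.exists_isHomogeneous_aux (s := s) (by simpa using hs) _ rfl _ ∅ 𝓡
    rfl (by simp)
  refine ⟨𝓗, h𝓗.trans h𝓡, ?_, hhom⟩
  rw [Fintype.card_fin] at hc
  rw [mul_assoc]
  exact hc.trans (Nat.mul_le_mul_left _ hHc)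

end Homogenization

theorem choose_succ_le_choose_sub_add (m c r : ℕ) :
    m.choose (r + 1) ≤ (m - c).choose (r + 1) + c * m.choose r := by
  induction c with
  | zero => simp
  | succ c ih =>
    refine ih.trans ?_
    have h1 : (m - c).choose (r + 1) ≤ (m - (c + 1)).choose (r + 1) + m.choose r := by
      rcases Nat.eq_zero_or_pos (m - c) with h0 | h0
      · simp [h0]
      · obtain ⟨d, hd⟩ := Nat.exists_eq_succ_of_ne_zero h0.ne'
        have hd' : m - (c + 1) = d := by omega
        rw [hd, hd', Nat.choose_succ_succ, add_comm]
        exact Nat.add_le_add_left (Nat.choose_le_choose r (by omega)) _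
    rw [add_mul, one_mul]
    omega

theorem pow_le_mul_choose {n m L r k : ℕ} (hrk : r ≤ k) (hL : 0 < L) (h : n ≤ L * (m + 1 - r)) :
    n ^ r ≤ L ^ k * k.factorial * m.choose r := by
  have h1 : (m + 1 - r) ^ r ≤ r.factorial * m.choose r := by
    have h2 := Nat.pow_le_choose (α := ℚ) r m
    rw [div_le_iff₀ (by exact_mod_cast r.factorial_pos), mul_comm] at h2
    exact_mod_cast h2
  calc n ^ r ≤ (L * (m + 1 - r)) ^ r := Nat.pow_le_pow_left h r
    _ = L ^ r * (m + 1 - r) ^ r := mul_pow _ _ _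
    _ ≤ L ^ k * (k.factorial * m.choose r) := Nat.mul_le_mul (Nat.pow_le_pow_right hL hrk)
        (h1.trans (Nat.mul_le_mul_right _ (Nat.factorial_le hrk)))
    _ = L ^ k * k.factorial * m.choose r := by ring

open scoped FinsetFamily

section Shadow

variable {n r p : ℕ} {𝒬 𝒢 : Finset (Finset (Fin n))}

theorem choose_le_card_shadow (h𝒬 : (𝒬 : Set (Finset (Fin n))).Sized (r + 1)) (hrp : r + 1 ≤ p)
    (hpn : p ≤ n) (h : p.choose (r + 1) ≤ 𝒬.card) : p.choose r ≤ (∂ 𝒬).card := by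
  simpa using Finset.kruskal_katona_lovasz_form (i := 1) (by omega) hrp hpn h𝒬 h

theorem mul_card_le_mul_card_shadow (h𝒬 : (𝒬 : Set (Finset (Fin n))).Sized (r + 1))
    (hpn : p ≤ n) (h : 𝒬.card < p.choose (r + 1)) : (r + 1) * 𝒬.card ≤ p * (∂ 𝒬).card := by
  rcases 𝒬.eq_empty_or_nonempty with rfl | hne
  · simp
  induction p with
  | zero => simp at h
  | succ p ih =>
    by_cases h' : 𝒬.card < p.choose (r + 1)
    · exact (ih (by omega) h').trans (Nat.mul_le_mul_right _ (by omega))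
    have hrp : r + 1 ≤ p := by
      by_contra! hlt
      have h1 := hne.card_pos
      have h2 := Nat.choose_le_choose (r + 1) (show p + 1 ≤ r + 1 by omega)
      rw [Nat.choose_self] at h2
      omega
    have h1 := choose_le_card_shadow h𝒬 hrp (by omega) (not_lt.1 h')
    have h2 := Nat.add_one_mul_choose_eq p r
    calc (r + 1) * 𝒬.card ≤ (r + 1) * (p + 1).choose (r + 1) := Nat.mul_le_mul_left _ h.le
      _ = (p + 1) * p.choose r := by rw [h2, mul_comm]
      _ ≤ (p + 1) * (∂ 𝒬).card := Nat.mul_le_mul_left _ h1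

theorem card_le_mul_card_of_shadow_subset (h𝒬 : (𝒬 : Set (Finset (Fin n))).Sized (r + 1))
    (hrp : r + 1 ≤ p) (hpn : p ≤ n) (hsub : ∂ 𝒬 ⊆ 𝒢) (h : 𝒢.card < p.choose r) :
    𝒬.card ≤ p * 𝒢.card := by
  have h1 := Finset.card_le_card hsub
  have h2 : 𝒬.card < p.choose (r + 1) := by
    by_contra! h2
    have := choose_le_card_shadow h𝒬 hrp hpn h2
    omega
  calc 𝒬.card ≤ (r + 1) * 𝒬.card := Nat.le_mul_of_pos_left _ (by omega)
    _ ≤ p * (∂ 𝒬).card := mul_card_le_mul_card_shadow h𝒬 hpn h2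
    _ ≤ p * 𝒢.card := Nat.mul_le_mul_left _ h1

end Shadow

section Structure

variable {n k t : ℕ} {𝓕 : Finset (Finset (Fin n))}

theorem exists_card_le_mul_card_shadow (k t : ℕ) (htk : 2 * t + 1 < k) :
    ∃ K, ∀ (n : ℕ) (𝓕 𝒜 : Finset (Finset (Fin n))), (∀ F ∈ 𝓕, F.card = k) →
      (∀ A ∈ 𝓕, ∀ B ∈ 𝓕, A ≠ B → (A ∩ B).card ≠ t) →
      (∀ F ∈ 𝓕, ∀ A ⊆ F, A.card = k - t - 1 → A ∈ 𝒜) → 𝓕.card ≤ K * 𝒜.card := by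
  obtain ⟨K, hK⟩ := exists_isHomogeneous k (k + 1) (by omega) (by omega)
  refine ⟨K, fun n 𝓕 𝒜 hk hav h𝒜 => ?_⟩
  obtain ⟨𝓗, h𝓗, hc, hhom⟩ := hK n 𝓕 hk
  refine hc.trans (Nat.mul_le_mul_left _ ?_)
  have := fun F (hF : F ∈ 𝓗) => hhom.exists_isOwn (fun F hF => hk F (h𝓗 hF)) htk
    (fun A hA B hB => hav A (h𝓗 hA) B (h𝓗 hB)) hF
  choose! a ha hown using this
  refine Finset.card_le_card_of_injOn a (fun F hF => h𝒜 F (h𝓗 hF) _ (hown F hF).1 (ha F hF)) ?_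
  intro F hF F' hF' heq
  exact (hown F' hF').2 F hF (heq ▸ (hown F hF).1)

/-- Most members of a large `t`-avoiding family have a core. -/
theorem exists_two_mul_card_le (k t : ℕ) (htk : 2 * t + 1 < k) :
    ∃ K, ∀ (n : ℕ) (𝓕 : Finset (Finset (Fin n))), (∀ F ∈ 𝓕, F.card = k) →
      (∀ A ∈ 𝓕, ∀ B ∈ 𝓕, A ≠ B → (A ∩ B).card ≠ t) →
      ∃ 𝓖 ⊆ 𝓕, (∀ F ∈ 𝓖, ∃ D, D.card = t + 1 ∧ IsCore (k + 1) 𝓕 F D) ∧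
        2 * 𝓕.card ≤ 𝓖.card + n.choose (k - t - 1) + K * n.choose (k - t - 2) := by
  classical
  obtain ⟨K, hK⟩ := exists_isHomogeneous k (k + 1) (by omega) (by omega)
  refine ⟨2 * K, fun n 𝓕 hk hav => ?_⟩
  set S : Finset (Fin n) → Finset (Finset (Fin n)) := fun F =>
    (Finset.univ.powersetCard (k - t - 1)).filter fun A => IsOwn 𝓕 F A with hS
  set 𝓖 := 𝓕.filter fun F => ∃ D, D.card = t + 1 ∧ IsCore (k + 1) 𝓕 F D with h𝓖
  set 𝓣 := (𝓕 \ 𝓖).filter fun F => 2 ≤ (S F).card with h𝓣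
  set 𝓡 := (𝓕 \ 𝓖).filter fun F => ¬ 2 ≤ (S F).card with h𝓡
  have h𝓖𝓕 : 𝓖 ⊆ 𝓕 := Finset.filter_subset _ _
  have h𝓡𝓕 : 𝓡 ⊆ 𝓕 := (Finset.filter_subset _ _).trans Finset.sdiff_subset
  have h𝓣𝓕 : 𝓣 ⊆ 𝓕 := (Finset.filter_subset _ _).trans Finset.sdiff_subset
  refine ⟨𝓖, h𝓖𝓕, fun F hF => (Finset.mem_filter.1 hF).2, ?_⟩
  have hcard : 𝓣.card + 𝓡.card + 𝓖.card = 𝓕.card := by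
    rw [h𝓣, h𝓡, Finset.card_filter_add_card_filter_not]
    exact Finset.card_sdiff_add_card_eq_card h𝓖𝓕
  have hown : 𝓖.card + 2 * 𝓣.card ≤ n.choose (k - t - 1) := by
    have hdis : Disjoint 𝓖 𝓣 := Finset.disjoint_of_subset_right (Finset.filter_subset _ _)
      Finset.disjoint_sdiff
    have h1 : ((𝓖 ∪ 𝓣).biUnion S).card ≤ n.choose (k - t - 1) := by
      have := Finset.card_powersetCard (k - t - 1) (Finset.univ : Finset (Fin n))
      rw [Finset.card_univ, Fintype.card_fin] at this
      rw [← this]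
      exact Finset.card_le_card (Finset.biUnion_subset.2 fun F _ => Finset.filter_subset _ _)
    rw [Finset.card_biUnion, Finset.sum_union hdis] at h1
    · have h2 : 𝓖.card ≤ ∑ F ∈ 𝓖, (S F).card := by
        rw [Finset.card_eq_sum_ones]
        refine Finset.sum_le_sum fun F hF => ?_
        obtain ⟨hF𝓕, D, hD, hcore⟩ := Finset.mem_filter.1 hF
        refine Finset.card_pos.2 ⟨F \ D, Finset.mem_filter.2 ⟨?_, ?_⟩⟩
        · rw [Finset.mem_powersetCard, Finset.card_sdiff_of_subset hcore.1, hk F hF𝓕, hD]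
          exact ⟨Finset.subset_univ _, by omega⟩
        · exact hcore.isOwn hk (by omega) (by omega) hav hF𝓕 hD htk
      have h3 : 𝓣.card • 2 ≤ ∑ F ∈ 𝓣, (S F).card :=
        Finset.card_nsmul_le_sum 𝓣 (fun F => (S F).card) 2 fun F hF => (Finset.mem_filter.1 hF).2
      rw [smul_eq_mul] at h3
      omega
    · intro F hF F' hF' hne
      rw [Function.onFun, Finset.disjoint_left]
      intro A hA hA'
      rw [Finset.coe_union] at hF
      have hF𝓕 : F ∈ 𝓕 := hF.elim (fun h => h𝓖𝓕 h) fun h => h𝓣𝓕 h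
      exact hne ((Finset.mem_filter.1 hA').2.2 F hF𝓕 (Finset.mem_filter.1 hA).2.1)
  have hR : 𝓡.card ≤ K * n.choose (k - t - 2) := by
    obtain ⟨𝓗, h𝓗, hc, hhom⟩ := hK n 𝓡 fun F hF => hk F (h𝓡𝓕 hF)
    refine hc.trans (Nat.mul_le_mul_left _ ?_)
    have : ∀ F ∈ 𝓗, ∃ B, B.card = k - t - 2 ∧ IsOwn 𝓗 F B := by
      intro F hF
      obtain ⟨hF', hF2⟩ := Finset.mem_filter.1 (h𝓗 hF)
      obtain ⟨hF𝓕, hF𝓖⟩ := Finset.mem_sdiff.1 hF'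
      rcases hhom.isCore_or_exists_isOwn hk htk hav (by omega) (h𝓗.trans h𝓡𝓕) hF with
        hcore | ⟨A, A', hne, hA, hA', hoA, hoA'⟩ | hB
      · exact absurd (Finset.mem_filter.2 ⟨hF𝓕, hcore⟩) hF𝓖
      · refine absurd ?_ hF2
        exact Finset.one_lt_card.2 ⟨A, by simp [hS, hA, hoA], A', by simp [hS, hA', hoA'], hne⟩
      · exact hB
    choose! b hb hbo using this
    have h1 := Finset.card_powersetCard (k - t - 2) (Finset.univ : Finset (Fin n))
    rw [Finset.card_univ, Fintype.card_fin] at h1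
    rw [← h1]
    refine Finset.card_le_card_of_injOn b (fun F hF => by simp [hb F hF]) ?_
    intro F hF F' hF' heq
    exact (hbo F' hF').2 F hF (heq ▸ (hbo F hF).1)
  have := mul_assoc 2 K (n.choose (k - t - 2))
  omega

/-- If almost all possible sets have cores, then some core occurs almost always. -/
theorem exists_choose_le_card_core (htk : 2 * t + 1 < k) (hk : ∀ F ∈ 𝓕, F.card = k)
    (hav : ∀ A ∈ 𝓕, ∀ B ∈ 𝓕, A ≠ B → (A ∩ B).card ≠ t) {𝓖 : Finset (Finset (Fin n))}
    (h𝓖 : 𝓖 ⊆ 𝓕) (hcore : ∀ F ∈ 𝓖, ∃ D, D.card = t + 1 ∧ IsCore (k + 1) 𝓕 F D) (K c : ℕ)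
    (hc : c = (k - t - 1) * (K + 1)) (hn : c ≤ n)
    (hcard : n.choose (k - t - 1) ≤ 𝓖.card + K * n.choose (k - t - 2)) :
    ∃ D, D.card = t + 1 ∧ (n - c).choose (k - t - 1) ≤ (𝓕.filter fun F => D ⊆ F).card := by
  classical
  obtain ⟨r, hr⟩ : ∃ r, k - t - 1 = r + 1 := ⟨k - t - 2, by omega⟩
  have hr' : k - t - 2 = r := by omega
  rw [hr] at hc hcard ⊢
  rw [hr'] at hcard
  by_contra! hcon
  choose! d hd hdcore using hcore
  set L : Finset (Fin n) → Finset (Finset (Fin n)) := fun D =>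
    (𝓖.filter fun F => d F = D).image fun F => F \ D with hL
  have hLsized : ∀ D, (L D : Set (Finset (Fin n))).Sized (r + 1) := by
    intro D A hA
    obtain ⟨F, hF, rfl⟩ := Finset.mem_image.1 (Finset.mem_coe.1 hA)
    obtain ⟨hF₀, rfl⟩ := Finset.mem_filter.1 hF
    rw [Finset.card_sdiff_of_subset (hdcore F hF₀).1, hk F (h𝓖 hF₀), hd F hF₀]
    omega
  have hLcard : ∀ D, (L D).card = (𝓖.filter fun F => d F = D).card := by
    intro D
    refine Finset.card_image_of_injOn fun F hF F' hF' heq => ?_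
    obtain ⟨hF₀, hFD⟩ := Finset.mem_filter.1 (Finset.mem_coe.1 hF)
    obtain ⟨hF₀', hFD'⟩ := Finset.mem_filter.1 (Finset.mem_coe.1 hF')
    have h1 : F \ D ∪ D = F := Finset.sdiff_union_of_subset (hFD ▸ (hdcore F hF₀).1)
    have h2 : F' \ D ∪ D = F' := Finset.sdiff_union_of_subset (hFD' ▸ (hdcore F' hF₀').1)
    rw [← h1, ← h2]
    exact congrArg (· ∪ D) heq
  have hsh : ∀ D ∈ 𝓖.image d, (r + 1) * (𝓖.filter fun F => d F = D).card ≤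
      (n - c) * (∂ (L D)).card := by
    intro D hD
    obtain ⟨F, hF, rfl⟩ := Finset.mem_image.1 hD
    rw [← hLcard]
    refine mul_card_le_mul_card_shadow (hLsized _) (by omega) ?_
    rw [hLcard]
    refine (Finset.card_le_card fun F' hF' => ?_).trans_lt (hcon (d F) (hd F hF))
    obtain ⟨hF', heq⟩ := Finset.mem_filter.1 hF'
    exact Finset.mem_filter.2 ⟨h𝓖 hF', heq ▸ (hdcore F' hF').1⟩
  have hsum := Finset.sum_le_sum hsh
  have hmem : ∀ D, ∀ Y ∈ ∂ (L D), Y.card = r ∧ ∃ F ∈ 𝓖, d F = D ∧ Y ⊂ F \ D := by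
    intro D Y hY
    have hYc := Set.Sized.shadow (hLsized D) (Finset.mem_coe.2 hY)
    refine ⟨by simpa using hYc, ?_⟩
    obtain ⟨A, hA, a, haA, rfl⟩ := Finset.mem_shadow_iff.1 hY
    obtain ⟨F, hF, rfl⟩ := Finset.mem_image.1 hA
    obtain ⟨hF, hFD⟩ := Finset.mem_filter.1 hF
    exact ⟨F, hF, hFD, Finset.erase_ssubset haA⟩
  have hdis : ∑ D ∈ 𝓖.image d, (∂ (L D)).card ≤ n.choose r := by
    have h1 := Finset.card_powersetCard r (Finset.univ : Finset (Fin n))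
    rw [Finset.card_univ, Fintype.card_fin] at h1
    rw [← Finset.card_biUnion, ← h1]
    · refine Finset.card_le_card (Finset.biUnion_subset.2 fun D _ Y hY => ?_)
      simp [(hmem D Y hY).1]
    · intro D _ D' _ hne
      rw [Function.onFun, Finset.disjoint_left]
      intro Y hY hY'
      obtain ⟨hYc, F, hF, rfl, hYF⟩ := hmem D Y hY
      obtain ⟨-, F', hF', rfl, hYF'⟩ := hmem D' Y hY'
      exact IsCore.card_inter_sdiff_lt hk (by omega) hav htk (hd F hF) (hd F' hF') hne
        (hdcore F hF) (hdcore F' hF') Y (by omega) hYF hYF'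
  rw [← Finset.mul_sum, ← Finset.mul_sum, ← Finset.card_eq_sum_card_image d 𝓖] at hsum
  have h1 : (r + 1) * 𝓖.card ≤ (n - c) * n.choose r := hsum.trans (Nat.mul_le_mul_left _ hdis)
  have h2 : n.choose (r + 1) * (r + 1) = n.choose r * (n - r) := Nat.choose_succ_right_eq n r
  have h3 := Nat.mul_le_mul_left (r + 1) hcard
  have h4 : (n - c) + (r + 1) * K + 1 ≤ n - r := by
    have : c = (r + 1) * K + r + 1 := by rw [hc]; ring
    omega
  have h5 : 0 < n.choose r := Nat.choose_pos (by
    have : c = (r + 1) * K + r + 1 := by rw [hc]; ring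
    have := Nat.zero_le ((r + 1) * K)
    omega)
  have h6 := Nat.mul_le_mul_right (n.choose r) h4
  nlinarith

end Structure

/-- The `N`-sets disjoint from `D` that do not extend `D` to a member of `𝓕`. -/
def missingSets {n : ℕ} (N : ℕ) (𝓕 : Finset (Finset (Fin n))) (D : Finset (Fin n)) :
    Finset (Finset (Fin n)) :=
  (Dᶜ.powersetCard N).filter fun E => D ∪ E ∉ 𝓕

section Missing

variable {n k t : ℕ} {𝓕 : Finset (Finset (Fin n))} {D F T : Finset (Fin n)}

theorem card_filter_superset_add_card_missingSets (hk : ∀ F ∈ 𝓕, F.card = k) (hD : D.card = t + 1) :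
    (𝓕.filter fun F => D ⊆ F).card + (missingSets (k - t - 1) 𝓕 D).card =
      (n - t - 1).choose (k - t - 1) := by
  have h1 := Finset.card_filter_add_card_filter_not (s := Dᶜ.powersetCard (k - t - 1))
    (fun E => D ∪ E ∈ 𝓕)
  rw [Finset.card_powersetCard, Finset.card_compl, Fintype.card_fin, hD] at h1
  rw [show n - t - 1 = n - (t + 1) by omega, ← h1, missingSets]
  congr 1
  refine Finset.card_bij' (fun F _ => F \ D) (fun E _ => D ∪ E) ?_ ?_ ?_ ?_
  · intro F hF
    obtain ⟨hF, hDF⟩ := Finset.mem_filter.1 hF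
    rw [Finset.mem_filter, Finset.mem_powersetCard, Finset.union_sdiff_of_subset hDF,
      Finset.card_sdiff_of_subset hDF, hk F hF, hD]
    exact ⟨⟨fun x hx => by simpa using (Finset.mem_sdiff.1 hx).2, by omega⟩, hF⟩
  · intro E hE
    exact Finset.mem_filter.2 ⟨(Finset.mem_filter.1 hE).2, Finset.subset_union_left⟩
  · intro F hF
    exact Finset.union_sdiff_of_subset (Finset.mem_filter.1 hF).2
  · intro E hE
    have := (Finset.mem_powersetCard.1 (Finset.mem_filter.1 hE).1).1
    exact Finset.union_sdiff_cancel_left (Finset.subset_compl_iff_disjoint_left.1 this)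

theorem choose_le_card_missingSets_superset (hk : ∀ F ∈ 𝓕, F.card = k) (htk : 2 * t + 1 < k)
    (hav : ∀ A ∈ 𝓕, ∀ B ∈ 𝓕, A ≠ B → (A ∩ B).card ≠ t) (hD : D.card = t + 1) (hF : F ∈ 𝓕)
    (hT : T ⊆ F \ D) (hTc : (F ∩ D).card + T.card = t) :
    (n - (t + 1) - k).choose (k - t - 1 - T.card) ≤
      ((missingSets (k - t - 1) 𝓕 D).filter fun E => T ⊆ E).card := by
  have h1 : n - (t + 1) - k ≤ (D ∪ F)ᶜ.card := by
    rw [Finset.card_compl, Fintype.card_fin]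
    have := Finset.card_union_le D F
    rw [hD, hk F hF] at this
    omega
  refine (Nat.choose_le_choose _ h1).trans ?_
  rw [← Finset.card_powersetCard]
  have hdisW : ∀ W ⊆ (D ∪ F)ᶜ, Disjoint T W := by
    intro W hW
    rw [Finset.disjoint_left]
    intro x hx hxW
    have h2 := hW hxW
    have h3 := hT hx
    simp only [Finset.mem_compl, Finset.mem_union, Finset.mem_sdiff] at h2 h3
    tauto
  refine Finset.card_le_card_of_injOn (fun W => T ∪ W) ?_ ?_
  · intro W hW
    obtain ⟨hW, hWc⟩ := Finset.mem_powersetCard.1 (Finset.mem_coe.1 hW)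
    refine Finset.mem_coe.2 (Finset.mem_filter.2 ⟨Finset.mem_filter.2 ⟨Finset.mem_powersetCard.2
      ⟨fun x hx => ?_, ?_⟩, fun hmem => ?_⟩, Finset.subset_union_left⟩)
    · rcases Finset.mem_union.1 hx with hx | hx
      · simpa using (Finset.mem_sdiff.1 (hT hx)).2
      · have := hW hx
        simp only [Finset.mem_compl, Finset.mem_union] at this ⊢
        tauto
    · rw [Finset.card_union_of_disjoint (hdisW W hW), hWc]
      omega
    · have h4 : F ∩ (D ∪ (T ∪ W)) = F ∩ D ∪ T := by
        ext x
        have h5 : x ∈ T → x ∈ F \ D := fun h => hT h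
        have h6 : x ∈ W → x ∈ (D ∪ F)ᶜ := fun h => hW h
        simp only [Finset.mem_compl, Finset.mem_union, Finset.mem_sdiff, Finset.mem_inter] at *
        tauto
      refine hav F hF _ hmem (fun heq => ?_) ?_
      · have h5 : D ⊆ F := heq ▸ Finset.subset_union_left
        rw [Finset.inter_eq_right.2 h5, hD] at hTc
        omega
      · rw [h4, Finset.card_union_of_disjoint, hTc]
        rw [Finset.disjoint_left]
        intro x hx hxT
        exact (Finset.mem_sdiff.1 (hT hxT)).2 (Finset.mem_inter.1 hx).2
  · intro W hW W' hW' heq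
    obtain ⟨hW, -⟩ := Finset.mem_powersetCard.1 (Finset.mem_coe.1 hW)
    obtain ⟨hW', -⟩ := Finset.mem_powersetCard.1 (Finset.mem_coe.1 hW')
    have h2 := congrArg (· \ T) heq
    simpa [Finset.union_sdiff_cancel_left (hdisW W hW),
      Finset.union_sdiff_cancel_left (hdisW W' hW')] using h2

theorem card_mul_le_two_pow_mul {α : Type*} [DecidableEq α] (𝒢 ℳ : Finset (Finset α)) (N c : ℕ)
    (hℳ : ∀ E ∈ ℳ, E.card = N) (h : ∀ T ∈ 𝒢, c ≤ (ℳ.filter fun E => T ⊆ E).card) :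
    𝒢.card * c ≤ 2 ^ N * ℳ.card := by
  have h1 := Finset.card_nsmul_le_sum 𝒢 (fun T => (ℳ.filter fun E => T ⊆ E).card) c h
  have h2 := Finset.sum_card_bipartiteAbove_eq_sum_card_bipartiteBelow (s := 𝒢) (t := ℳ)
    (fun T E => T ⊆ E)
  simp only [Finset.bipartiteAbove, Finset.bipartiteBelow] at h2
  rw [smul_eq_mul, h2] at h1
  refine h1.trans ?_
  rw [mul_comm, ← smul_eq_mul]
  refine Finset.sum_le_card_nsmul _ _ _ fun E hE => ?_
  rw [← hℳ E hE, ← Finset.card_powerset]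
  exact Finset.card_le_card fun T hT => Finset.mem_powerset.2 (Finset.mem_filter.1 hT).2

/-- The `a`-sets contained in `F \ D` for some `F ∈ 𝓑`. -/
def outerShadow (a : ℕ) (𝓑 : Finset (Finset (Fin n))) (D : Finset (Fin n)) :
    Finset (Finset (Fin n)) :=
  𝓑.biUnion fun F => (F \ D).powersetCard a

variable {𝓑 : Finset (Finset (Fin n))} {a : ℕ}

theorem mem_outerShadow : T ∈ outerShadow a 𝓑 D ↔ ∃ F ∈ 𝓑, T ⊆ F \ D ∧ T.card = a := by
  simp [outerShadow, Finset.mem_powersetCard]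

theorem sized_outerShadow : (outerShadow a 𝓑 D : Set (Finset (Fin n))).Sized a := by
  intro T hT
  obtain ⟨-, -, -, h⟩ := mem_outerShadow.1 (Finset.mem_coe.1 hT)
  exact h

theorem shadow_outerShadow_subset : ∂ (outerShadow (a + 1) 𝓑 D) ⊆ outerShadow a 𝓑 D := by
  intro T hT
  obtain ⟨Q, hQ, x, hx, rfl⟩ := Finset.mem_shadow_iff.1 hT
  obtain ⟨F, hF, hQF, hQc⟩ := mem_outerShadow.1 hQ
  refine mem_outerShadow.2 ⟨F, hF, (Finset.erase_subset _ _).trans hQF, ?_⟩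
  rw [Finset.card_erase_of_mem hx, hQc]
  omega

theorem mem_image_union_of_card_inter {A : Finset (Fin n)} {N j : ℕ} (hF : F ∈ 𝓑)
    (hj : (F ∩ D).card = j) (hAF : A ⊆ F) (hA : A.card = N) (hN : j + a + 1 ≤ N) :
    A ∈ (outerShadow (a + 1) 𝓑 D ×ˢ Finset.univ.powersetCard (N - a - 1)).image
      fun p => p.1 ∪ p.2 := by
  have h1 : a + 1 ≤ (A \ D).card := by
    have h2 := Finset.card_sdiff_add_card_inter A D
    have h3 := Finset.card_le_card (Finset.inter_subset_inter_right hAF (u := D))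
    omega
  obtain ⟨Q, hQ, hQc⟩ := Finset.exists_subset_card_eq h1
  have hQA : Q ⊆ A := hQ.trans Finset.sdiff_subset
  refine Finset.mem_image.2 ⟨(Q, A \ Q), ?_, Finset.union_sdiff_of_subset hQA⟩
  refine Finset.mem_product.2 ⟨mem_outerShadow.2 ⟨F, hF, ?_, hQc⟩, ?_⟩
  · exact hQ.trans (Finset.sdiff_subset_sdiff hAF subset_rfl)
  · rw [Finset.mem_powersetCard, Finset.card_sdiff_of_subset hQA, hA, hQc]
    exact ⟨Finset.subset_univ _, by omega⟩

/-- The members of `𝓕` meeting `D` in `j ≤ t` elements are few compared to the missing sets. -/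
theorem exists_mul_card_filter_le_card_missingSets (k t c : ℕ) (htk : 2 * t + 1 < k) :
    ∃ n₁, ∀ n ≥ n₁, ∀ (𝓕 : Finset (Finset (Fin n))) (D : Finset (Fin n)),
      (∀ F ∈ 𝓕, F.card = k) → (∀ A ∈ 𝓕, ∀ B ∈ 𝓕, A ≠ B → (A ∩ B).card ≠ t) → D.card = t + 1 →
      (missingSets (k - t - 1) 𝓕 D).card ≤ c * n ^ (k - t - 2) → ∀ j ≤ t,
      (t + 1) * (𝓕.filter fun F => (F ∩ D).card = j).card ≤
        (missingSets (k - t - 1) 𝓕 D).card := by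
  obtain ⟨K, hK⟩ := exists_card_le_mul_card_shadow k t htk
  set N := k - t - 1 with hN
  set c₁ := 2 ^ k * k.factorial with hc₁
  set X := (K + 1) * c₁ * 2 ^ N with hX
  have hXpos : 0 < X := by positivity
  set q := (t + 1) * X with hq
  have hqpos : 0 < q := by positivity
  set c₂ := (2 * q) ^ k * k.factorial with hc₂
  refine ⟨c₁ * 2 ^ N * c * c₂ + 4 * k + 2 * q * k + 1,
    fun n hn 𝓕 D hk hav hD hM j hj => ?_⟩
  obtain ⟨a, ha⟩ : ∃ a, j + a = t := ⟨t - j, by omega⟩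
  set ℳ := missingSets N 𝓕 D with hℳ
  set 𝓑 := 𝓕.filter fun F => (F ∩ D).card = j with h𝓑
  set 𝒢 := outerShadow a 𝓑 D with h𝒢
  set p := n / q with hp
  have hqp : q * p ≤ n := Nat.mul_div_le n q
  have hpn : p ≤ n := Nat.div_le_self n q
  have hkp : 2 * k ≤ p := by
    rw [hp, Nat.le_div_iff_mul_le hqpos]
    have : 2 * k * q = 2 * q * k := by ring
    rw [this]
    have := Nat.zero_le (c₁ * 2 ^ N * c * c₂)
    omega
  have hn4 : 4 * k ≤ n := by
    have := Nat.zero_le (c₁ * 2 ^ N * c * c₂)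
    have := Nat.zero_le (2 * q * k)
    omega
  have hchoose : n ^ (N - a) ≤ c₁ * (n - (t + 1) - k).choose (N - a) :=
    pow_le_mul_choose (by omega) (by omega) (by omega)
  have hchoosep : n ^ a ≤ c₂ * p.choose a := by
    refine pow_le_mul_choose (by omega) (by omega) ?_
    have h1 : n < q * (p + 1) := Nat.lt_mul_div_succ n hqpos
    have h2 : q * (p + 1) ≤ q * (2 * (p + 1 - a)) := Nat.mul_le_mul_left _ (by omega)
    calc n ≤ q * (2 * (p + 1 - a)) := by omega
      _ = 2 * q * (p + 1 - a) := by ring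
  have hdouble : 𝒢.card * (n - (t + 1) - k).choose (N - a) ≤ 2 ^ N * ℳ.card := by
    refine card_mul_le_two_pow_mul 𝒢 ℳ N _ (fun E hE => ?_) fun T hT => ?_
    · exact (Finset.mem_powersetCard.1 (Finset.mem_filter.1 hE).1).2
    · obtain ⟨F, hF, hTF, rfl⟩ := mem_outerShadow.1 hT
      obtain ⟨hF, hFj⟩ := Finset.mem_filter.1 hF
      exact choose_le_card_missingSets_superset hk htk hav hD hF hTF (by omega)
  have hGpow : 𝒢.card * n ^ (N - a) ≤ c₁ * 2 ^ N * ℳ.card := by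
    calc 𝒢.card * n ^ (N - a) ≤ 𝒢.card * (c₁ * (n - (t + 1) - k).choose (N - a)) :=
          Nat.mul_le_mul_left _ hchoose
      _ = c₁ * (𝒢.card * (n - (t + 1) - k).choose (N - a)) := by ring
      _ ≤ c₁ * (2 ^ N * ℳ.card) := Nat.mul_le_mul_left _ hdouble
      _ = c₁ * 2 ^ N * ℳ.card := by ring
  have hnpos : 0 < n := by omega
  have hGp : 𝒢.card < p.choose a := by
    have h1 : 𝒢.card * n ≤ c₁ * 2 ^ N * c * n ^ a := by
      refine Nat.le_of_mul_le_mul_right ?_ (pow_pos hnpos (N - a))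
      calc 𝒢.card * n * n ^ (N - a) = n * (𝒢.card * n ^ (N - a)) := by ring
        _ ≤ n * (c₁ * 2 ^ N * (c * n ^ (k - t - 2))) :=
          Nat.mul_le_mul_left _ (hGpow.trans (Nat.mul_le_mul_left _ hM))
        _ = c₁ * 2 ^ N * c * n ^ (k - t - 2 + 1) := by ring
        _ = c₁ * 2 ^ N * c * n ^ (a + (N - a)) := by
          congr 2
          omega
        _ = c₁ * 2 ^ N * c * n ^ a * n ^ (N - a) := by rw [pow_add]; ring
    have h2 : 0 < p.choose a := Nat.choose_pos (by omega)
    refine Nat.lt_of_mul_lt_mul_right (a := n) ?_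
    calc 𝒢.card * n ≤ c₁ * 2 ^ N * c * (c₂ * p.choose a) :=
          h1.trans (Nat.mul_le_mul_left _ hchoosep)
      _ = c₁ * 2 ^ N * c * c₂ * p.choose a := by ring
      _ < n * p.choose a := Nat.mul_lt_mul_of_pos_right
          (by have := Nat.zero_le (2 * q * k); omega) h2
      _ = p.choose a * n := mul_comm _ _
  have hQ : (outerShadow (a + 1) 𝓑 D).card ≤ p * 𝒢.card :=
    card_le_mul_card_of_shadow_subset sized_outerShadow (by omega) hpn
      shadow_outerShadow_subset hGp
  have hB : 𝓑.card ≤ K * ((outerShadow (a + 1) 𝓑 D).card * n ^ (N - a - 1)) := by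
    have h𝓑𝓕 : 𝓑 ⊆ 𝓕 := Finset.filter_subset _ _
    refine (hK n 𝓑 _ (fun F hF => hk F (h𝓑𝓕 hF))
      (fun A hA B hB => hav A (h𝓑𝓕 hA) B (h𝓑𝓕 hB)) fun F hF A hAF hA =>
        mem_image_union_of_card_inter (a := a) hF (Finset.mem_filter.1 hF).2 hAF hA
          (by omega)).trans
      (Nat.mul_le_mul_left _ (Finset.card_image_le.trans ?_))
    rw [Finset.card_product, Finset.card_powersetCard, Finset.card_univ, Fintype.card_fin]
    exact Nat.mul_le_mul_left _ (Nat.choose_le_pow _ _)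
  refine (Nat.mul_le_mul_left_iff hXpos).1 ?_
  calc X * ((t + 1) * 𝓑.card) = q * 𝓑.card := by rw [hq]; ring
    _ ≤ q * (K * (p * 𝒢.card * n ^ (N - a - 1))) :=
      Nat.mul_le_mul_left _ (hB.trans (Nat.mul_le_mul_left _ (Nat.mul_le_mul_right _ hQ)))
    _ = K * 𝒢.card * (q * p * n ^ (N - a - 1)) := by ring
    _ ≤ K * 𝒢.card * (n * n ^ (N - a - 1)) :=
      Nat.mul_le_mul_left _ (Nat.mul_le_mul_right _ hqp)
    _ = K * (𝒢.card * n ^ (N - a - 1 + 1)) := by ring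
    _ = K * (𝒢.card * n ^ (N - a)) := by
      rw [show N - a - 1 + 1 = N - a by omega]
    _ ≤ (K + 1) * (c₁ * 2 ^ N * ℳ.card) := Nat.mul_le_mul (by omega) hGpow
    _ = X * ℳ.card := by rw [hX]; ring

end Missing

/-- The upper bound in the Frankl–Füredi theorem. -/
theorem exists_card_le_choose_of_avoiding (k t : ℕ) (htk : 2 * t + 1 < k) :
    ∃ n₀, ∀ n > n₀, ∀ 𝓕 : Finset (Finset (Fin n)), (∀ F ∈ 𝓕, F.card = k) →
      (∀ A ∈ 𝓕, ∀ B ∈ 𝓕, A ≠ B → (A ∩ B).card ≠ t) →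
      𝓕.card ≤ (n - t - 1).choose (k - t - 1) := by
  obtain ⟨K, hK⟩ := exists_two_mul_card_le k t htk
  set c := (k - t - 1) * ((2 * (t + 1) + K) + 1) with hc
  obtain ⟨n₁, hn₁⟩ := exists_mul_card_filter_le_card_missingSets k t c htk
  refine ⟨c + n₁, fun n hn 𝓕 hk hav => ?_⟩
  by_contra! hlt
  obtain ⟨𝓖, h𝓖, hcore, h𝓖c⟩ := hK n 𝓕 hk hav
  have hsub : ∀ d, n.choose (k - t - 1) ≤
      (n - d).choose (k - t - 1) + d * n.choose (k - t - 2) := by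
    intro d
    have := choose_succ_le_choose_sub_add n d (k - t - 2)
    rwa [show k - t - 2 + 1 = k - t - 1 by omega] at this
  have hcard : n.choose (k - t - 1) ≤ 𝓖.card + (2 * (t + 1) + K) * n.choose (k - t - 2) := by
    have h1 := hsub (t + 1)
    rw [show n - (t + 1) = n - t - 1 by omega] at h1
    rw [add_mul, mul_assoc]
    omega
  obtain ⟨D, hD, hDc⟩ := exists_choose_le_card_core htk hk hav h𝓖 hcore _ c hc (by omega) hcard
  have hM := card_filter_superset_add_card_missingSets (t := t) hk hD
  have hMc : (missingSets (k - t - 1) 𝓕 D).card ≤ c * n ^ (k - t - 2) := by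
    have h1 := hsub c
    have h2 : c * n.choose (k - t - 2) ≤ c * n ^ (k - t - 2) :=
      Nat.mul_le_mul_left _ (Nat.choose_le_pow _ _)
    have h3 := Nat.choose_le_choose (k - t - 1) (show n - t - 1 ≤ n by omega)
    omega
  have hB := hn₁ n (by omega) 𝓕 D hk hav hD hMc
  have hsplit : (𝓕.filter fun F => ¬ D ⊆ F).card ≤
      ∑ j ∈ Finset.range (t + 1), (𝓕.filter fun F => (F ∩ D).card = j).card := by
    refine (Finset.card_le_card fun F hF => ?_).trans Finset.card_biUnion_le
    obtain ⟨hF, hDF⟩ := Finset.mem_filter.1 hF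
    refine Finset.mem_biUnion.2 ⟨(F ∩ D).card, ?_, Finset.mem_filter.2 ⟨hF, rfl⟩⟩
    rw [Finset.mem_range, ← hD]
    exact Finset.card_lt_card ⟨Finset.inter_subset_right,
      fun h => hDF (h.trans Finset.inter_subset_left)⟩
  have hsum : ∑ j ∈ Finset.range (t + 1), (t + 1) * (𝓕.filter fun F => (F ∩ D).card = j).card ≤
      (t + 1) * (missingSets (k - t - 1) 𝓕 D).card := by
    have := Finset.sum_le_card_nsmul (Finset.range (t + 1)) _ _
      fun j hj => hB j (by rw [Finset.mem_range] at hj; omega)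
    rwa [Finset.card_range, smul_eq_mul] at this
  rw [← Finset.mul_sum, Nat.mul_le_mul_left_iff (by omega)] at hsum
  have := Finset.card_filter_add_card_filter_not (s := 𝓕) (fun F => D ⊆ F)
  omega

theorem le_alphaJ (n k t : ℕ) (htk : t + 1 ≤ k) (hn : t + 1 ≤ n) :
    (n - t - 1).choose (k - t - 1) ≤ alphaJ n k t := by
  have hdis : ∀ E ⊆ Finset.Icc (t + 2) n, Disjoint (Finset.Icc 1 (t + 1)) E := by
    intro E hE
    rw [Finset.disjoint_left]
    intro x hx hxE
    have h1 := Finset.mem_Icc.1 (hE hxE)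
    have h2 := Finset.mem_Icc.1 hx
    omega
  set 𝓕 := ((Finset.Icc (t + 2) n).powersetCard (k - t - 1)).image
    fun E => Finset.Icc 1 (t + 1) ∪ E with h𝓕
  have hcard : 𝓕.card = (n - t - 1).choose (k - t - 1) := by
    rw [h𝓕, Finset.card_image_of_injOn, Finset.card_powersetCard, Nat.card_Icc]
    · congr 1
      omega
    · intro E hE E' hE' heq
      have h1 := (Finset.mem_powersetCard.1 (Finset.mem_coe.1 hE)).1
      have h2 := (Finset.mem_powersetCard.1 (Finset.mem_coe.1 hE')).1
      have h3 := congrArg (· \ Finset.Icc 1 (t + 1)) heq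
      simpa [Finset.union_sdiff_cancel_left (hdis E h1),
        Finset.union_sdiff_cancel_left (hdis E' h2)] using h3
  rw [← hcard]
  refine Finset.le_sup (f := Finset.card) (Finset.mem_filter.2 ⟨?_, ?_⟩)
  · rw [Finset.mem_powerset]
    intro F hF
    obtain ⟨E, hE, rfl⟩ := Finset.mem_image.1 hF
    obtain ⟨hE, hEc⟩ := Finset.mem_powersetCard.1 hE
    refine Finset.mem_powersetCard.2 ⟨Finset.union_subset ?_ ?_, ?_⟩
    · exact Finset.Icc_subset_Icc_right hn
    · exact hE.trans (Finset.Icc_subset_Icc_left (by omega))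
    · rw [Finset.card_union_of_disjoint (hdis E hE), hEc, Nat.card_Icc]
      omega
  · intro A hA B hB _
    obtain ⟨E, -, rfl⟩ := Finset.mem_image.1 hA
    obtain ⟨E', -, rfl⟩ := Finset.mem_image.1 hB
    have := Finset.card_le_card (Finset.subset_inter
      (Finset.subset_union_left (s₁ := Finset.Icc 1 (t + 1)) (s₂ := E))
      (Finset.subset_union_left (s₁ := Finset.Icc 1 (t + 1)) (s₂ := E')))
    rw [Nat.card_Icc] at this
    omega

/-- Transfer from subsets of `{1,…,n}` to subsets of `Fin n`. -/
theorem alphaJ_le_of_forall_fin (n k t m : ℕ)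
    (h : ∀ 𝓕 : Finset (Finset (Fin n)), (∀ F ∈ 𝓕, F.card = k) →
      (∀ A ∈ 𝓕, ∀ B ∈ 𝓕, A ≠ B → (A ∩ B).card ≠ t) → 𝓕.card ≤ m) : alphaJ n k t ≤ m := by
  refine Finset.sup_le fun 𝓕 h𝓕 => ?_
  obtain ⟨h𝓕, hav⟩ := Finset.mem_filter.1 h𝓕
  rw [Finset.mem_powerset] at h𝓕
  set f : Finset ℕ → Finset (Fin n) := fun A => Finset.univ.filter fun i => (i : ℕ) + 1 ∈ A with hf
  have hmap : ∀ A ⊆ Finset.Icc 1 n, (f A).image (fun i : Fin n => (i : ℕ) + 1) = A := by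
    intro A hA
    ext x
    simp only [hf, Finset.mem_image, Finset.mem_filter, Finset.mem_univ, true_and]
    constructor
    · rintro ⟨i, hi, rfl⟩
      exact hi
    · intro hx
      have h1 := Finset.mem_Icc.1 (hA hx)
      have h2 : x - 1 + 1 = x := by omega
      exact ⟨⟨x - 1, by omega⟩, by simpa [h2] using hx, h2⟩
  have hcard : ∀ A ⊆ Finset.Icc 1 n, (f A).card = A.card := by
    intro A hA
    conv_rhs => rw [← hmap A hA]
    refine (Finset.card_image_of_injective _ fun i j hij => ?_).symm
    ext
    simpa using hij
  have hinter : ∀ A B, f A ∩ f B = f (A ∩ B) := by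
    intro A B
    ext i
    simp [hf]
  have hsub : ∀ A ∈ 𝓕, A ⊆ Finset.Icc 1 n := fun A hA => (Finset.mem_powersetCard.1 (h𝓕 hA)).1
  rw [← Finset.card_image_of_injOn (s := 𝓕) (f := f)]
  · refine h _ (fun F hF => ?_) fun A hA B hB hne => ?_
    · obtain ⟨A, hA, rfl⟩ := Finset.mem_image.1 hF
      rw [hcard A (hsub A hA)]
      exact (Finset.mem_powersetCard.1 (h𝓕 hA)).2
    · obtain ⟨A, hA', rfl⟩ := Finset.mem_image.1 hA
      obtain ⟨B, hB', rfl⟩ := Finset.mem_image.1 hB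
      rw [hinter, hcard _ (Finset.inter_subset_left.trans (hsub A hA'))]
      exact hav A hA' B hB' fun heq => hne (congrArg f heq)
  · intro A hA B hB heq
    rw [← hmap A (hsub A hA), ← hmap B (hsub B hB), heq]

/-- Frankl–Füredi: for `k > 2t+1` and `n` large, `α(G(n,k,t)) = C(n-t-1, k-t-1)`. -/
theorem frankl_furedi_large_k (k t : ℕ) (hk : 0 < k) (ht : 0 < t) (h : 2 * t + 1 < k) :
    ∃ n₀ : ℕ, ∀ n > n₀, alphaJ n k t = (n - t - 1).choose (k - t - 1) := by
  obtain ⟨n₀, hn₀⟩ := exists_card_le_choose_of_avoiding k t h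
  refine ⟨n₀ + t, fun n hn => le_antisymm ?_ (le_alphaJ n k t (by omega) (by omega))⟩
  exact alphaJ_le_of_forall_fin n k t _ (hn₀ n (by omega))
end

section
/- Fix positive integers k and t with k ≥ 2t+1. For every ε > 0 there exist a constant C > 0 and n₀ such that for all n > n₀ and every integer ℓ with C·n^{k-t-1} ≤ ℓ ≤ C(n,k), one has ρ_{n,k,t}(ℓ) ≥ (1-ε) · ℓ² · t! / (2·n^t). -/
/-- The number of unordered pairs of distinct sets `F₁, F₂ ∈ F` with `|F₁ ∩ F₂| = t`. -/
def rhoPairs (t : ℕ) (F : Finset (Finset ℕ)) : ℕ :=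
  ((F.powersetCard 2).filter
    (fun P => ∃ A ∈ P, ∃ B ∈ P, A ≠ B ∧ (A ∩ B).card = t)).card

/-- `ρ_{n,k,t}(ℓ)`: the minimum of `ρ(F)` over families `F` of `k`-element subsets
of `[n]` with `|F| = ℓ`. -/
noncomputable def rhoMin (n k t ℓ : ℕ) : ℕ :=
  sInf { m : ℕ | ∃ F : Finset (Finset ℕ),
    F ⊆ (Finset.Icc 1 n).powersetCard k ∧ F.card = ℓ ∧ rhoPairs t F = m }

theorem exists_card_add_card_filter_subset_eq_of_shrink {α ι : Type*} [DecidableEq α]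
    (X : Finset α) (S : Finset ι) (B : ι → Finset α) (τ : ℕ)
    (ih : ∀ X' : Finset α, X'.card < X.card → ∀ (S' : Finset ι) (B' : ι → Finset α) (τ' : ℕ),
      (∀ i ∈ S', B' i ⊆ X') → S'.card ≤ τ' → τ' < X'.card →
      ∃ V ⊆ X', V.card + (S'.filter fun i => B' i ⊆ V).card = τ')
    (hB : ∀ i ∈ S, B i ⊆ X) (V₀ W : Finset α) (hV₀ : V₀ ⊆ X) (hW : W ⊆ X) (hd : Disjoint V₀ W)
    (hne : 0 < V₀.card + W.card)
    (h₁ : S.card + V₀.card ≤ τ + (S.filter fun i => ¬ Disjoint (B i) W).card)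
    (h₂ : τ + W.card + 1 ≤ X.card + (S.filter fun i => B i ⊆ V₀).card) :
    ∃ V ⊆ X, V.card + (S.filter fun i => B i ⊆ V).card = τ := by
  classical
  set R := X \ (V₀ ∪ W) with hR
  set S' := S.filter (fun i => Disjoint (B i) W ∧ ¬ B i ⊆ V₀) with hS'
  have hcR : R.card + (V₀.card + W.card) = X.card := by
    rw [← Finset.card_union_of_disjoint hd]
    exact Finset.card_sdiff_add_card_eq_card (Finset.union_subset hV₀ hW)
  have hcS : S.card = S'.card + (S.filter fun i => ¬ Disjoint (B i) W).card
      + (S.filter fun i => B i ⊆ V₀).card := by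
    rw [← Finset.card_union_of_disjoint, ← Finset.card_union_of_disjoint]
    · congr 1
      ext i
      simp only [hS', Finset.mem_union, Finset.mem_filter]
      tauto
    · rw [Finset.disjoint_left]
      intro i hi hi'
      simp only [hS', Finset.mem_union, Finset.mem_filter] at hi hi'
      have : Disjoint (B i) W := Finset.disjoint_of_subset_left hi'.2 hd
      tauto
    · rw [Finset.disjoint_left]
      intro i hi hi'
      simp only [hS', Finset.mem_filter] at hi hi'
      tauto
  obtain ⟨Q, hQ, hQc⟩ := ih R (by omega) S' (fun i => B i \ V₀)
    (τ - V₀.card - (S.filter fun i => B i ⊆ V₀).card)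
    (by
      intro i hi x hx
      simp only [hS', Finset.mem_filter] at hi
      simp only [Finset.mem_sdiff] at hx
      simp only [hR, Finset.mem_sdiff, Finset.mem_union, not_or]
      exact ⟨hB i hi.1 hx.1, hx.2, Finset.disjoint_left.1 hi.2.1 hx.1⟩)
    (by omega) (by omega)
  have hQd : Disjoint V₀ Q := by
    rw [Finset.disjoint_left]
    intro x hx hxQ
    have := hQ hxQ
    simp only [hR, Finset.mem_sdiff, Finset.mem_union, not_or] at this
    exact this.2.1 hx
  refine ⟨V₀ ∪ Q, Finset.union_subset hV₀ (hQ.trans Finset.sdiff_subset), ?_⟩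
  have hf : (S.filter fun i => B i ⊆ V₀ ∪ Q).card
      = (S.filter fun i => B i ⊆ V₀).card + (S'.filter fun i => B i \ V₀ ⊆ Q).card := by
    rw [← Finset.card_union_of_disjoint]
    · congr 1
      ext i
      simp only [hS', Finset.mem_union, Finset.mem_filter]
      constructor
      · rintro ⟨hi, hs⟩
        by_cases h0 : B i ⊆ V₀
        · exact Or.inl ⟨hi, h0⟩
        · refine Or.inr ⟨⟨hi, ?_, h0⟩, ?_⟩
          · rw [Finset.disjoint_left]
            intro x hx hxW
            rcases Finset.mem_union.1 (hs hx) with h | h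
            · exact Finset.disjoint_left.1 hd h hxW
            · have := hQ h
              simp only [hR, Finset.mem_sdiff, Finset.mem_union, not_or] at this
              exact this.2.2 hxW
          · exact sdiff_le_iff.2 hs
      · rintro (⟨hi, h0⟩ | ⟨⟨hi, -⟩, hs⟩)
        · exact ⟨hi, h0.trans Finset.subset_union_left⟩
        · exact ⟨hi, sdiff_le_iff.1 hs⟩
    · rw [Finset.disjoint_left]
      intro i hi hi'
      simp only [hS', Finset.mem_filter] at hi hi'
      exact hi'.1.2.2 hi.2
  rw [Finset.card_union_of_disjoint hQd, hf]
  omega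

/-- Conway's double counting. -/
theorem exists_notMem_card_le_degree {α ι : Type*} [DecidableEq α]
    (X : Finset α) (S : Finset ι) (B : ι → Finset α) (hB : ∀ i ∈ S, B i ⊆ X)
    (hX : X.card = S.card + 1) (hmiss : ∀ x ∈ X, ∃ i ∈ S, x ∉ B i) :
    ∃ x ∈ X, ∃ i ∈ S, x ∉ B i ∧ (B i).card ≤ (S.filter fun j => x ∈ B j).card := by
  classical
  by_contra! hcon
  have hXne : X.Nonempty := Finset.card_pos.1 (by omega)
  obtain ⟨x₀, hx₀⟩ := hXne
  obtain ⟨i₀, hi₀, -⟩ := hmiss x₀ hx₀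
  have hm : 0 < S.card := Finset.card_pos.2 ⟨i₀, hi₀⟩
  have hmQ : (0 : ℚ) < S.card := by exact_mod_cast hm
  have hnQ : (0 : ℚ) < X.card := by rw [hX]; positivity
  set u : α → ℚ := fun x => 1 / (X.card * (S.filter fun j => x ∉ B j).card)
  set v : ι → ℚ := fun i => 1 / (S.card * (X.filter fun x => x ∉ B i).card)
  have hlt : ∀ x ∈ X, ∀ i ∈ S, x ∉ B i → u x < v i := by
    intro x hx i hi hxi
    have h1 := hcon x hx i hi hxi
    have hc1 : (S.filter fun j => x ∈ B j).card + (S.filter fun j => x ∉ B j).card = S.card :=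
      Finset.card_filter_add_card_filter_not _
    have hc2 : (B i).card + (X.filter fun x => x ∉ B i).card = X.card := by
      have := Finset.card_filter_add_card_filter_not (s := X) (fun x => x ∈ B i)
      rwa [Finset.filter_mem_eq_inter, Finset.inter_eq_right.2 (hB i hi)] at this
    have hp : 0 < (X.filter fun x => x ∉ B i).card :=
      Finset.card_pos.2 ⟨x, Finset.mem_filter.2 ⟨hx, hxi⟩⟩
    apply one_div_lt_one_div_of_lt
    · exact mul_pos hmQ (by exact_mod_cast hp)
    · have : S.card * (X.filter fun x => x ∉ B i).card
          < X.card * (S.filter fun j => x ∉ B j).card := by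
        set a := (S.filter fun j => x ∈ B j).card
        set a' := (S.filter fun j => x ∉ B j).card
        set b := (B i).card
        set b' := (X.filter fun x => x ∉ B i).card
        have : b' ≤ a' := by omega
        have ha' : 0 < a' := by omega
        rw [hX]
        nlinarith
      exact_mod_cast this
  have hsum1 : ∑ x ∈ X, ∑ i ∈ S.filter (fun i => x ∉ B i), u x = 1 := by
    have : ∀ x ∈ X, ∑ i ∈ S.filter (fun i => x ∉ B i), u x = 1 / X.card := by
      intro x hx
      obtain ⟨i, hi, hxi⟩ := hmiss x hx
      have hp : (0 : ℚ) < (S.filter fun j => x ∉ B j).card := by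
        exact_mod_cast Finset.card_pos.2 ⟨i, Finset.mem_filter.2 ⟨hi, hxi⟩⟩
      rw [Finset.sum_const, nsmul_eq_mul]
      simp only [u]
      field_simp
    rw [Finset.sum_congr rfl this, Finset.sum_const, nsmul_eq_mul]
    field_simp
  have hsum2 : ∑ i ∈ S, ∑ x ∈ X.filter (fun x => x ∉ B i), v i ≤ 1 := by
    have : ∀ i ∈ S, ∑ x ∈ X.filter (fun x => x ∉ B i), v i ≤ 1 / S.card := by
      intro i hi
      rw [Finset.sum_const, nsmul_eq_mul]
      simp only [v]
      rcases Nat.eq_zero_or_pos (X.filter fun x => x ∉ B i).card with h0 | h0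
      · rw [h0]; simp
      · have : (0 : ℚ) < (X.filter fun x => x ∉ B i).card := by exact_mod_cast h0
        apply le_of_eq
        field_simp
    refine (Finset.sum_le_sum this).trans ?_
    rw [Finset.sum_const, nsmul_eq_mul]
    apply le_of_eq
    field_simp
  have hswap : ∑ i ∈ S, ∑ x ∈ X.filter (fun x => x ∉ B i), v i
      = ∑ x ∈ X, ∑ i ∈ S.filter (fun i => x ∉ B i), v i := by
    apply Finset.sum_comm'
    intro i x
    simp only [Finset.mem_filter]
    tauto
  have hstrict : ∑ x ∈ X, ∑ i ∈ S.filter (fun i => x ∉ B i), u x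
      < ∑ x ∈ X, ∑ i ∈ S.filter (fun i => x ∉ B i), v i := by
    apply Finset.sum_lt_sum_of_nonempty ⟨x₀, hx₀⟩
    intro x hx
    obtain ⟨i, hi, hxi⟩ := hmiss x hx
    apply Finset.sum_lt_sum_of_nonempty ⟨i, Finset.mem_filter.2 ⟨hi, hxi⟩⟩
    intro j hj
    rw [Finset.mem_filter] at hj
    exact hlt x hx j hj.1 hj.2
  linarith

/-- A form of the Frankl–Katona theorem: in a hypergraph with fewer edges than vertices some
vertex set satisfies `|V| + e(V) = τ`, for each `τ` between these two numbers. -/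
theorem exists_card_add_card_filter_subset_eq {α ι : Type*} [DecidableEq α]
    (X : Finset α) (S : Finset ι) (B : ι → Finset α) (τ : ℕ)
    (hB : ∀ i ∈ S, B i ⊆ X) (hS : S.card ≤ τ) (hX : τ < X.card) :
    ∃ V ⊆ X, V.card + (S.filter fun i => B i ⊆ V).card = τ := by
  classical
  induction hn : X.card using Nat.strong_induction_on generalizing X S B τ with
  | _ n ih =>
    subst hn
    have step := exists_card_add_card_filter_subset_eq_of_shrink X S B τ
      (fun X' hX' S' B' τ' h1 h2 h3 => ih _ hX' X' S' B' τ' h1 h2 h3 rfl) hB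
    obtain ⟨x, hx⟩ : X.Nonempty := Finset.card_pos.1 (by omega)
    by_cases h1 : S.card < τ
    · exact step {x} ∅ (by simpa using hx) (by simp) (by simp) (by simp)
        (by simp; omega) (by simp; omega)
    by_cases h2 : τ + 1 < X.card
    · exact step ∅ {x} (by simp) (by simpa using hx) (by simp) (by simp)
        (by simp; omega) (by simp; omega)
    by_cases h3 : ∃ x ∈ X, ∀ i ∈ S, x ∈ B i
    · obtain ⟨y, hy, hall⟩ := h3
      refine ⟨X.erase y, Finset.erase_subset _ _, ?_⟩
      have : S.filter (fun i => B i ⊆ X.erase y) = ∅ := by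
        rw [Finset.filter_eq_empty_iff]
        intro i hi hs
        exact Finset.notMem_erase y X (hs (hall i hi))
      rw [this, Finset.card_erase_of_mem hy, Finset.card_empty]
      omega
    · push Not at h3
      obtain ⟨y, hy, i, hi, hyi, hle⟩ :=
        exists_notMem_card_le_degree X S B hB (by omega) h3
      have hd : (S.filter fun j => ¬ Disjoint (B j) {y}) = S.filter fun j => y ∈ B j := by
        apply Finset.filter_congr
        intro j _
        simp
      have he : 0 < (S.filter fun j => B j ⊆ B i).card :=
        Finset.card_pos.2 ⟨i, Finset.mem_filter.2 ⟨hi, subset_rfl⟩⟩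
      refine step (B i) {y} (hB i hi) (by simpa using hy) (by simpa using hyi) (by simp) ?_ ?_
      · rw [hd]; omega
      · simp only [Finset.card_singleton]; omega

/-- An intersection-closed family of proper subsets covering all sets of size `|α| - t - 1` contains
a set of size `t`. -/
theorem exists_card_eq_of_inter_closed {α : Type*} [Fintype α] [DecidableEq α] (t : ℕ)
    (ht : 2 * t + 1 ≤ Fintype.card α) (J : Finset (Finset α))
    (huniv : Finset.univ ∉ J) (hinter : ∀ A ∈ J, ∀ B ∈ J, A ∩ B ∈ J)
    (hcover : ∀ A : Finset α, A.card = Fintype.card α - t - 1 → ∃ B ∈ J, A ⊆ B) :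
    ∃ B ∈ J, B.card = t := by
  classical
  have hcover' : ∀ A : Finset α, A.card ≤ Fintype.card α - t - 1 → ∃ B ∈ J, A ⊆ B := by
    intro A hA
    obtain ⟨A', hAA', -, hA'⟩ := Finset.exists_subsuperset_card_eq (Finset.subset_univ A) hA
      (by rw [Finset.card_univ]; omega)
    obtain ⟨B, hB, hsub⟩ := hcover A' hA'
    exact ⟨B, hB, hAA'.trans hsub⟩
  obtain ⟨I, hI⟩ := (Set.toFinite {I : Finset α | ∀ B ∈ J, ¬ Iᶜ ⊆ B}).exists_maximal
    ⟨∅, by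
      intro B hB hs
      rw [Finset.compl_empty, Finset.univ_subset_iff] at hs
      exact huniv (hs ▸ hB)⟩
  have hIs : ∀ B ∈ J, ¬ Iᶜ ⊆ B := hI.prop
  have hIc : I.card ≤ t := by
    by_contra! hlt
    obtain ⟨B, hB, hs⟩ := hcover' Iᶜ (by rw [Finset.card_compl]; omega)
    exact hIs B hB hs
  have hC : ∀ x : α, ∃ C : Finset α, x ∉ I → C ∈ J ∧ x ∉ C ∧ ∀ y, y ∉ I → y ≠ x → y ∈ C := by
    intro x
    by_cases hx : x ∈ I
    · exact ⟨∅, fun h => absurd hx h⟩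
    have : ¬ ∀ B ∈ J, ¬ (insert x I)ᶜ ⊆ B := by
      intro hmem
      have := hI.le_of_ge (y := insert x I) hmem (Finset.subset_insert x I)
      exact hx (this (Finset.mem_insert_self x I))
    push Not at this
    obtain ⟨C, hCJ, hs⟩ := this
    have hyC : ∀ y, y ∉ I → y ≠ x → y ∈ C := fun y hy hyx => hs (by simp [hy, hyx])
    refine ⟨C, fun _ => ⟨hCJ, fun hxC => hIs C hCJ ?_, hyC⟩⟩
    intro y hy
    by_cases hyx : y = x
    · exact hyx ▸ hxC
    · exact hyC y (by simpa using hy) hyx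
  choose C hC using hC
  obtain ⟨V, hV, hVc⟩ := exists_card_add_card_filter_subset_eq Iᶜ I
    (fun y => Iᶜ.filter fun x => y ∉ C x) t (fun _ _ => Finset.filter_subset _ _) hIc
    (by rw [Finset.card_compl]; omega)
  have hinf : ∀ W : Finset α, W.Nonempty → W ⊆ Iᶜ → W.inf C ∈ J := by
    intro W hW
    induction hW using Finset.Nonempty.cons_induction with
    | singleton a =>
      intro h
      rw [Finset.inf_singleton]
      exact (hC a (by simpa using h)).1
    | cons a s ha hs ih =>
      intro h
      rw [Finset.inf_cons]
      rw [Finset.cons_subset] at h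
      exact hinter _ (hC a (by simpa using h.1)).1 _ (ih h.2)
  have hWne : (Iᶜ \ V).Nonempty := by
    rw [← Finset.card_pos, Finset.card_sdiff_of_subset hV, Finset.card_compl]
    omega
  refine ⟨(Iᶜ \ V).inf C, hinf _ hWne Finset.sdiff_subset, ?_⟩
  rw [← hVc, ← Finset.card_union_of_disjoint]
  · congr 1
    ext y
    simp only [Finset.mem_inf, Finset.mem_union, Finset.mem_filter, Finset.mem_sdiff,
      Finset.mem_compl, Finset.subset_iff]
    constructor
    · intro h
      by_cases hy : y ∈ I
      · refine Or.inr ⟨hy, fun x hx => ?_⟩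
        by_contra hxV
        exact hx.2 (h x ⟨hx.1, hxV⟩)
      · left
        by_contra hyV
        exact (hC y hy).2.1 (h y ⟨hy, hyV⟩)
    · rintro (hy | ⟨hy, h⟩) x ⟨hx, hxV⟩
      · exact (hC x hx).2.2 y (by simpa using hV hy) (fun e => hxV (e ▸ hy))
      · by_contra hyx
        exact hxV (h ⟨hx, hyx⟩)
  · rw [Finset.disjoint_left]
    intro y hy hy'
    have := hV hy
    simp only [Finset.mem_compl, Finset.mem_filter] at this hy'
    exact this hy'.1

theorem exists_card_le_card_mul_card_fiber {β γ : Type*} [DecidableEq γ] (s : Finset β)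
    (t : Finset γ) (f : β → γ) (hf : ∀ a ∈ s, f a ∈ t) (ht : t.Nonempty) :
    ∃ y ∈ t, s.card ≤ t.card * (s.filter fun x => f x = y).card := by
  by_contra! h
  have h1 := Finset.sum_lt_sum_of_nonempty ht h
  rw [← Finset.mul_sum, ← Finset.card_eq_sum_card_fiberwise hf, Finset.sum_const,
    smul_eq_mul] at h1
  exact lt_irrefl _ h1

section Agreement

variable {ι α : Type*} [Fintype ι] [DecidableEq α]

/-- The coordinates on which two functions agree. -/
def agreeSet (f g : ι → α) : Finset ι := Finset.univ.filter fun i => f i = g i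

/-- A family of functions any two of which agree exactly on `B`. -/
def IsAgreeStar (B : Finset ι) (S : Finset (ι → α)) : Prop :=
  ∀ f ∈ S, ∀ g ∈ S, f ≠ g → agreeSet f g = B

/-- `𝓕` contains a star of type `B` with at least `s` members agreeing with `f` on `B`. -/
def HasAgreeStarAt (𝓕 : Finset (ι → α)) (s : ℕ) (B : Finset ι) (f : ι → α) : Prop :=
  ∃ S ⊆ 𝓕, s ≤ S.card ∧ IsAgreeStar B S ∧ ∀ g ∈ S, B ⊆ agreeSet f g

@[simp] theorem mem_agreeSet {f g : ι → α} {i : ι} : i ∈ agreeSet f g ↔ f i = g i := by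
  simp [agreeSet]

theorem agreeSet_ne_univ {f g : ι → α} (h : f ≠ g) : agreeSet f g ≠ Finset.univ := by
  intro he
  apply h
  funext i
  rw [← mem_agreeSet, he]
  exact Finset.mem_univ i

theorem IsAgreeStar.exists_forall_ne {B : Finset ι} {S : Finset (ι → α)} (hS : IsAgreeStar B S)
    (hc : Fintype.card ι < S.card) (h : ι → α) : ∃ g ∈ S, ∀ i, i ∉ B → g i ≠ h i := by
  by_contra! hcon
  have : ∀ g : S, ∃ i, i ∉ B ∧ g.1 i = h i := fun g => hcon g.1 g.2
  choose e he using this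
  obtain ⟨⟨f, hf⟩, ⟨g, hg⟩, hne, hfg⟩ := Fintype.exists_ne_map_eq_of_card_lt e (by simpa using hc)
  have h1 := he ⟨f, hf⟩
  have h2 := he ⟨g, hg⟩
  rw [← hfg] at h2
  apply h1.1
  rw [← hS f hf g hg (by simpa using hne), mem_agreeSet]
  exact h1.2.trans h2.2.symm

theorem exists_subfamily_forall_agreeSet_ne (𝓖 : Finset (ι → α)) (s : ℕ) (B : Finset ι)
    (hB : B ≠ Finset.univ) (hstar : ∀ S ⊆ 𝓖, IsAgreeStar B S → S.card < s) :
    ∃ 𝓖' ⊆ 𝓖, 𝓖.card ≤ (s * Fintype.card ι) * 𝓖'.card ∧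
      ∀ f ∈ 𝓖', ∀ g ∈ 𝓖', f ≠ g → agreeSet f g ≠ B := by
  classical
  obtain ⟨i₀, hi₀⟩ : ∃ i₀, i₀ ∉ B := by
    by_contra! h
    exact hB (Finset.eq_univ_of_forall h)
  have hs : 0 < s := by simpa using hstar ∅ (by simp) (by simp [IsAgreeStar])
  let r : (ι → α) → (B → α) := fun f i => f i
  have hr : ∀ f g, r f = r g → B ⊆ agreeSet f g := by
    intro f g h i hi
    exact mem_agreeSet.2 (congrFun h ⟨i, hi⟩)
  have hT : ∀ X : B → α, ∃ T : Finset (ι → α), T ⊆ 𝓖.filter (fun f => r f = X) ∧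
      IsAgreeStar B T ∧ ∀ f ∈ 𝓖, r f = X → f ∉ T → ∃ g ∈ T, agreeSet f g ≠ B := by
    intro X
    obtain ⟨T, hT⟩ := ((𝓖.filter (fun f => r f = X)).powerset.filter
      (fun T => IsAgreeStar B T)).exists_maximal
        ⟨∅, Finset.mem_filter.2 ⟨Finset.empty_mem_powerset _, by simp [IsAgreeStar]⟩⟩
    have hp := hT.prop
    rw [Finset.mem_filter, Finset.mem_powerset] at hp
    refine ⟨T, hp.1, hp.2, fun f hf hfX hfT => ?_⟩
    by_contra! hcon
    refine hfT (hT.le_of_ge (y := insert f T) ?_ (Finset.subset_insert f T)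
      (Finset.mem_insert_self f T))
    rw [Finset.mem_filter, Finset.mem_powerset]
    refine ⟨Finset.insert_subset (Finset.mem_filter.2 ⟨hf, hfX⟩) hp.1, ?_⟩
    have hsymm : ∀ a b : ι → α, agreeSet a b = agreeSet b a := by
      intro a b
      ext i
      simp [eq_comm]
    intro a ha b hb hab
    rw [Finset.mem_insert] at ha hb
    rcases ha with rfl | ha <;> rcases hb with rfl | hb
    · exact absurd rfl hab
    · exact hcon b hb
    · rw [hsymm]; exact hcon a ha
    · exact hp.2 a ha b hb hab
  choose T hTsub hTstar hTmax using hT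
  have hG : ∀ f, ∃ gi : (ι → α) × ι, f ∈ 𝓖 → gi.1 ∈ T (r f) ∧ gi.2 ∉ B ∧ f gi.2 = gi.1 gi.2 := by
    intro f
    by_cases hf : f ∈ 𝓖
    · by_cases hfT : f ∈ T (r f)
      · exact ⟨(f, i₀), fun _ => ⟨hfT, hi₀, rfl⟩⟩
      · obtain ⟨g, hg, hne⟩ := hTmax (r f) f hf rfl hfT
        have hgr : r f = r g := ((Finset.mem_filter.1 (hTsub _ hg)).2).symm
        obtain ⟨i, hi, hiB⟩ := Finset.exists_of_ssubset
          ((hr f g hgr).ssubset_of_ne (Ne.symm hne))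
        exact ⟨(g, i), fun _ => ⟨hg, hiB, mem_agreeSet.1 hi⟩⟩
    · exact ⟨(f, i₀), fun h => absurd h hf⟩
  choose G hG using hG
  let c : (ι → α) → ℕ × ι := fun f => ((T (r f)).toList.idxOf (G f).1, (G f).2)
  obtain ⟨y, -, hy⟩ := exists_card_le_card_mul_card_fiber 𝓖 (Finset.range s ×ˢ Finset.univ) c
    (by
      intro f hf
      simp only [c, Finset.mem_product, Finset.mem_range, Finset.mem_univ, and_true]
      refine lt_of_lt_of_le (List.idxOf_lt_length_of_mem (Finset.mem_toList.2 (hG f hf).1)) ?_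
      rw [Finset.length_toList]
      exact (hstar _ ((hTsub _).trans (Finset.filter_subset _ _)) (hTstar _)).le)
    ⟨(0, i₀), by simp [hs]⟩
  refine ⟨_, Finset.filter_subset _ _, by simpa using hy, ?_⟩
  intro f hf g hg _ he
  rw [Finset.mem_filter] at hf hg
  have hrfg : r f = r g := by
    funext i
    have h : (i : ι) ∈ agreeSet f g := he.symm.subset i.2
    exact (mem_agreeSet.1 h : f i = g i)
  have hc : c f = c g := hf.2.trans hg.2.symm
  simp only [c, Prod.mk.injEq, hrfg] at hc
  have hGf := hG f hf.1
  have hGg := hG g hg.1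
  rw [hrfg] at hGf
  have h1 : (G f).1 = (G g).1 := (List.idxOf_inj (Finset.mem_toList.2 hGf.1)).1 hc.1
  apply hGf.2.1
  rw [← he, mem_agreeSet, hGf.2.2, h1, hc.2, hGg.2.2]

theorem exists_self_kernel_and_assignment (𝒜 : Finset (Finset ι)) (s : ℕ) (hs : 0 < s)
    (𝓕 : Finset (ι → α)) :
    ∃ 𝓕' ⊆ 𝓕, (∀ B ∈ 𝒜, ∀ f ∈ 𝓕', HasAgreeStarAt 𝓕' s B f) ∧
      ∃ β : (ι → α) → Finset ι, (∀ f ∈ 𝓕, f ∉ 𝓕' → β f ∈ 𝒜) ∧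
        ∀ B ∈ 𝒜, ∀ S ⊆ 𝓕, (∀ f ∈ S, f ∉ 𝓕' ∧ β f = B) → IsAgreeStar B S → S.card < s := by
  classical
  induction hn : 𝓕.card using Nat.strong_induction_on generalizing 𝓕 with
  | _ n ih =>
    by_cases hall : ∀ B ∈ 𝒜, ∀ f ∈ 𝓕, HasAgreeStarAt 𝓕 s B f
    · refine ⟨𝓕, subset_rfl, hall, fun _ => ∅, fun f h1 h2 => absurd h1 h2, ?_⟩
      intro B _ S hS hS' _
      have : S = ∅ := Finset.eq_empty_of_forall_notMem fun f hf => (hS' f hf).1 (hS hf)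
      simpa [this] using hs
    · push Not at hall
      obtain ⟨B₀, hB₀, f₀, hf₀, hno⟩ := hall
      obtain ⟨𝓕', hsub, hker, β, hβ, hstar⟩ := ih (𝓕.erase f₀).card
        (hn ▸ Finset.card_erase_lt_of_mem hf₀) (𝓕.erase f₀) rfl
      refine ⟨𝓕', hsub.trans (Finset.erase_subset _ _), hker, Function.update β f₀ B₀, ?_, ?_⟩
      · intro f hf hf'
        by_cases h : f = f₀
        · subst h; simpa using hB₀
        · rw [Function.update_of_ne h]
          exact hβ f (Finset.mem_erase.2 ⟨h, hf⟩) hf'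
      · intro B hB S hS hSβ hSstar
        by_cases h : f₀ ∈ S
        · have hBB : B₀ = B := by simpa using (hSβ f₀ h).2
          subst hBB
          by_contra! hle
          refine hno ⟨S, hS, hle, hSstar, fun g hg i hi => ?_⟩
          by_cases hgf : f₀ = g
          · subst hgf; simp
          · rw [hSstar f₀ h g hg hgf]; exact hi
        · have hne : ∀ f ∈ S, f ≠ f₀ := fun f hf e => h (e ▸ hf)
          refine hstar B hB S (fun f hf => Finset.mem_erase.2 ⟨hne f hf, hS hf⟩) ?_ hSstar
          intro f hf
          have := hSβ f hf
          rwa [Function.update_of_ne (hne f hf)] at this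

/-- A form of Füredi's structure theorem for families of functions. -/
theorem exists_homogeneous_subfamily (s : ℕ) (hs : 0 < s) (n : ℕ) :
    ∃ M : ℕ, ∀ 𝒜 : Finset (Finset ι), 𝒜.card = n → Finset.univ ∉ 𝒜 →
      ∀ 𝓕 : Finset (ι → α), (∀ f ∈ 𝓕, ∀ g ∈ 𝓕, f ≠ g → agreeSet f g ∈ 𝒜) →
      ∃ 𝓕' ⊆ 𝓕, 𝓕.card ≤ M * 𝓕'.card ∧ ∃ J ⊆ 𝒜,
        (∀ f ∈ 𝓕', ∀ g ∈ 𝓕', f ≠ g → agreeSet f g ∈ J) ∧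
        ∀ B ∈ J, ∀ f ∈ 𝓕', HasAgreeStarAt 𝓕' s B f := by
  classical
  induction n with
  | zero =>
    refine ⟨1, fun 𝒜 h𝒜 _ 𝓕 h𝓕 => ⟨𝓕, subset_rfl, by simp, 𝒜, subset_rfl, h𝓕, ?_⟩⟩
    rw [Finset.card_eq_zero] at h𝒜
    simp [h𝒜]
  | succ n ih =>
    obtain ⟨M, hM⟩ := ih
    refine ⟨(n + 2) * (s * Fintype.card ι * M + 1), fun 𝒜 h𝒜 huniv 𝓕 h𝓕 => ?_⟩
    obtain ⟨𝓕', hsub, hker, β, hβ, hstar⟩ := exists_self_kernel_and_assignment 𝒜 s hs 𝓕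
    obtain ⟨y, hy, hcard⟩ := exists_card_le_card_mul_card_fiber 𝓕 (insert Finset.univ 𝒜)
      (fun f => if f ∈ 𝓕' then Finset.univ else β f)
      (by
        intro f hf
        by_cases h : f ∈ 𝓕'
        · simp [h]
        · simp only [h, if_false]
          exact Finset.mem_insert_of_mem (hβ f hf h))
      ⟨_, Finset.mem_insert_self _ _⟩
    rw [Finset.card_insert_of_notMem huniv, h𝒜] at hcard
    set 𝓖 := 𝓕.filter fun f => (if f ∈ 𝓕' then Finset.univ else β f) = y with h𝓖
    have h𝓖𝓕 : 𝓖 ⊆ 𝓕 := Finset.filter_subset _ _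
    rcases Finset.mem_insert.1 hy with rfl | hy
    · refine ⟨𝓕', hsub, ?_, 𝒜, subset_rfl,
        fun f hf g hg => h𝓕 f (hsub hf) g (hsub hg), hker⟩
      have hle : 𝓖.card ≤ 𝓕'.card := by
        apply Finset.card_le_card
        intro f hf
        rw [h𝓖, Finset.mem_filter] at hf
        by_contra h
        rw [if_neg h] at hf
        exact huniv (hf.2 ▸ hβ f hf.1 h)
      calc 𝓕.card ≤ (n + 2) * 𝓖.card := hcard
        _ ≤ (n + 2) * 𝓕'.card := by gcongr
        _ ≤ (n + 2) * (s * Fintype.card ι * M + 1) * 𝓕'.card := by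
          gcongr
          exact Nat.le_mul_of_pos_right _ (Nat.succ_pos _)
    · have hyu : y ≠ Finset.univ := fun e => huniv (e ▸ hy)
      obtain ⟨𝓖', hs', hc', hne'⟩ := exists_subfamily_forall_agreeSet_ne 𝓖 s y hyu (by
        intro S hS hSs
        refine hstar y hy S (hS.trans h𝓖𝓕) (fun f hf => ?_) hSs
        have := hS hf
        rw [h𝓖, Finset.mem_filter] at this
        by_cases h : f ∈ 𝓕'
        · rw [if_pos h] at this
          exact absurd this.2.symm hyu
        · rw [if_neg h] at this
          exact ⟨h, this.2⟩)
      obtain ⟨𝓗, h1, h2, J, h3, h4, h5⟩ := hM (𝒜.erase y)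
        (by rw [Finset.card_erase_of_mem hy, h𝒜]; rfl)
        (fun h => huniv (Finset.mem_of_mem_erase h)) 𝓖'
        (fun f hf g hg hfg => Finset.mem_erase.2 ⟨hne' f hf g hg hfg,
          h𝓕 f (h𝓖𝓕 (hs' hf)) g (h𝓖𝓕 (hs' hg)) hfg⟩)
      refine ⟨𝓗, h1.trans (hs'.trans h𝓖𝓕), ?_, J, h3.trans (Finset.erase_subset _ _), h4, h5⟩
      calc 𝓕.card ≤ (n + 2) * 𝓖.card := hcard
        _ ≤ (n + 2) * (s * Fintype.card ι * (M * 𝓗.card)) := by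
          gcongr
          exact hc'.trans (by gcongr)
        _ = (n + 2) * (s * Fintype.card ι * M) * 𝓗.card := by ring
        _ ≤ (n + 2) * (s * Fintype.card ι * M + 1) * 𝓗.card := by
          gcongr
          exact Nat.le_succ _

/-- The Frankl–Füredi theorem for families of functions. -/
theorem exists_isAgreeStar_of_card_lt (t s : ℕ) (ht : 2 * t + 1 ≤ Fintype.card ι)
    (hs : Fintype.card ι < s) :
    ∃ M : ℕ, ∀ (N : Finset α) (𝓕 : Finset (ι → α)), (∀ f ∈ 𝓕, ∀ i, f i ∈ N) →
      M * N.card ^ (Fintype.card ι - t - 1) < 𝓕.card →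
      ∃ B : Finset ι, B.card = t ∧ ∃ S ⊆ 𝓕, s ≤ S.card ∧ IsAgreeStar B S := by
  classical
  obtain ⟨M, hM⟩ := exists_homogeneous_subfamily (ι := ι) (α := α) s (by omega)
    (Finset.univ.erase (Finset.univ : Finset ι)).card
  refine ⟨M, fun N 𝓕 hN hcard => ?_⟩
  obtain ⟨𝓗, hsub, hle, J, hJ, hagree, hker⟩ := hM _ rfl (Finset.notMem_erase _ _) 𝓕
    (fun f _ g _ hfg => Finset.mem_erase.2 ⟨agreeSet_ne_univ hfg, Finset.mem_univ _⟩)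
  have hbig : N.card ^ (Fintype.card ι - t - 1) < 𝓗.card :=
    lt_of_mul_lt_mul_left (hcard.trans_le hle) (Nat.zero_le M)
  obtain ⟨f₀, hf₀⟩ : 𝓗.Nonempty := Finset.card_pos.1 (by omega)
  have hJu : Finset.univ ∉ J := fun h => Finset.notMem_erase _ _ (hJ h)
  have hinter : ∀ A ∈ J, ∀ B ∈ J, A ∩ B ∈ J := by
    intro A hA B hB
    obtain ⟨SA, hSA, hcA, hstA, hagA⟩ := hker A hA f₀ hf₀
    obtain ⟨SB, hSB, hcB, hstB, hagB⟩ := hker B hB f₀ hf₀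
    obtain ⟨P, hP, hPne⟩ := hstA.exists_forall_ne (hs.trans_le hcA) f₀
    obtain ⟨Q, hQ, hQne⟩ := hstB.exists_forall_ne (hs.trans_le hcB) P
    have hPQ : agreeSet P Q = A ∩ B := by
      ext i
      rw [mem_agreeSet, Finset.mem_inter]
      constructor
      · intro h
        have hiB : i ∈ B := by
          by_contra hiB
          exact hQne i hiB h.symm
        refine ⟨?_, hiB⟩
        by_contra hiA
        exact hPne i hiA (h.trans (mem_agreeSet.1 (hagB Q hQ hiB)).symm)
      · rintro ⟨hiA, hiB⟩
        rw [← mem_agreeSet.1 (hagA P hP hiA), mem_agreeSet.1 (hagB Q hQ hiB)]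
    rw [← hPQ]
    apply hagree P (hSA hP) Q (hSB hQ)
    rintro rfl
    have hAu : A = Finset.univ := by
      rw [← Finset.univ_subset_iff]
      intro i _
      have : i ∈ agreeSet P P := by simp
      rw [hPQ] at this
      exact (Finset.mem_inter.1 this).1
    exact hJu (hAu ▸ hA)
  have hcover : ∀ A : Finset ι, A.card = Fintype.card ι - t - 1 → ∃ B ∈ J, A ⊆ B := by
    intro A hA
    obtain ⟨f, hf, g, hg, hfg, heq⟩ := Finset.exists_ne_map_eq_of_card_lt_of_maps_to
      (s := 𝓗) (t := Fintype.piFinset fun _ : A => N) (f := fun f (i : A) => f i)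
      (by
        simp only [Fintype.card_piFinset, Finset.prod_const, Finset.card_univ, Fintype.card_coe, hA]
        exact hbig)
      (by
        intro f hf
        exact Fintype.mem_piFinset.2 fun i => hN f (hsub hf) i)
    exact ⟨_, hagree f hf g hg hfg, fun i hi => mem_agreeSet.2 (congrFun heq ⟨i, hi⟩)⟩
  obtain ⟨B, hB, hBt⟩ := exists_card_eq_of_inter_closed t ht J hJu hinter hcover
  obtain ⟨S, hS, hc, hst, -⟩ := hker B hB f₀ hf₀
  exact ⟨B, hBt, S, hS.trans hsub, hc, hst⟩

end Agreement

/-- A large family of `k`-sets contains a subfamily spread out around a `t`-element kernel. -/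
theorem exists_spread_of_card_lt {α : Type*} [LinearOrder α] (k t s : ℕ) (ht : 2 * t + 1 ≤ k) :
    ∃ M : ℕ, ∀ (N : Finset α) (F : Finset (Finset α)), F ⊆ N.powersetCard k →
      M * N.card ^ (k - t - 1) < F.card →
      ∃ T : Finset α, T.card = t ∧ ∃ S ⊆ F, S.Nonempty ∧ (∀ A ∈ S, T ⊆ A) ∧
        ∀ x, x ∉ T → s * (S.filter fun A => x ∈ A).card ≤ S.card := by
  classical
  obtain ⟨M, hM⟩ := exists_isAgreeStar_of_card_lt (ι := Fin k) (α := α) t (max (s * k) (k + 1))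
    (by simpa using ht) (by simp)
  refine ⟨M, fun N F hF hcard => ?_⟩
  have hφ : ∀ A : Finset α, ∃ f : Fin k → α, A ∈ F →
      Function.Injective f ∧ Finset.univ.image f = A := by
    intro A
    by_cases hA : A ∈ F
    · have hk := (Finset.mem_powersetCard.1 (hF hA)).2
      exact ⟨A.orderEmbOfFin hk, fun _ => ⟨(A.orderEmbOfFin hk).injective,
        Finset.image_orderEmbOfFin_univ A hk⟩⟩
    · have : Nonempty α := by
        obtain ⟨A, hA⟩ : F.Nonempty := Finset.card_pos.1 (by omega)
        have hk := (Finset.mem_powersetCard.1 (hF hA)).2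
        obtain ⟨a, -⟩ : A.Nonempty := Finset.card_pos.1 (by omega)
        exact ⟨a⟩
      exact ⟨fun _ => Classical.arbitrary α, fun h => absurd h hA⟩
  choose φ hφ using hφ
  have hinj : ∀ A ∈ F, ∀ B ∈ F, φ A = φ B → A = B := by
    intro A hA B hB h
    rw [← (hφ A hA).2, ← (hφ B hB).2, h]
  have hmem : ∀ A ∈ F, ∀ i, φ A i ∈ A := by
    intro A hA i
    have h := Finset.mem_image_of_mem (φ A) (Finset.mem_univ i)
    rwa [(hφ A hA).2] at h
  obtain ⟨B, hB, S, hS, hSc, hst⟩ := hM N (F.image φ)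
    (by
      intro f hf i
      obtain ⟨A, hA, rfl⟩ := Finset.mem_image.1 hf
      exact (Finset.mem_powersetCard.1 (hF hA)).1 (hmem A hA i))
    (by
      rw [Finset.card_image_of_injOn (s := F) (f := φ) fun A hA B hB h => hinj A hA B hB h,
        Fintype.card_fin]
      exact hcard)
  obtain ⟨S, hS', rfl⟩ := Finset.subset_image_iff.1 hS
  replace hS' : S ⊆ F := by exact_mod_cast hS'
  rw [Finset.card_image_of_injOn (s := S) (f := φ)
    fun A hA B hB h => hinj A (hS' hA) B (hS' hB) h] at hSc
  obtain ⟨A₀, hA₀⟩ : S.Nonempty := Finset.card_pos.1 (by omega)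
  have hagree : ∀ A ∈ S, ∀ i ∈ B, φ A i = φ A₀ i := by
    intro A hA i hi
    by_cases h : φ A = φ A₀
    · rw [h]
    · rw [← mem_agreeSet, hst _ (Finset.mem_image_of_mem _ hA) _ (Finset.mem_image_of_mem _ hA₀) h]
      exact hi
  refine ⟨B.image (φ A₀), ?_, S, hS', ⟨A₀, hA₀⟩, ?_, ?_⟩
  · rw [Finset.card_image_of_injective _ (hφ A₀ (hS' hA₀)).1, hB]
  · intro A hA x hx
    obtain ⟨i, hi, rfl⟩ := Finset.mem_image.1 hx
    rw [← hagree A hA i hi]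
    exact hmem A (hS' hA) i
  · intro x hx
    have hpos : ∀ A : Finset α, ∃ i : Fin k, A ∈ F → x ∈ A → φ A i = x := by
      intro A
      by_cases h : A ∈ F ∧ x ∈ A
      · have hx : x ∈ Finset.univ.image (φ A) := by rw [(hφ A h.1).2]; exact h.2
        obtain ⟨i, -, hi⟩ := Finset.mem_image.1 hx
        exact ⟨i, fun _ _ => hi⟩
      · exact ⟨⟨0, by omega⟩, fun h1 h2 => absurd ⟨h1, h2⟩ h⟩
    choose p hp using hpos
    have hle : (S.filter fun A => x ∈ A).card ≤ k := by
      have : (S.filter fun A => x ∈ A).card ≤ (Finset.univ : Finset (Fin k)).card := by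
        refine Finset.card_le_card_of_injOn p (fun _ _ => Finset.mem_univ _) ?_
        intro A hA A' hA' hpp
        rw [Finset.mem_coe, Finset.mem_filter] at hA hA'
        by_contra hne
        have h1 := hp A (hS' hA.1) hA.2
        have h2 := hp A' (hS' hA'.1) hA'.2
        rw [← hpp] at h2
        have hiB : p A ∈ B := by
          rw [← hst _ (Finset.mem_image_of_mem _ hA.1) _ (Finset.mem_image_of_mem _ hA'.1)
            (fun e => hne (hinj A (hS' hA.1) A' (hS' hA'.1) e)), mem_agreeSet, h1, h2]
        apply hx
        rw [← h1, hagree A hA.1 _ hiB]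
        exact Finset.mem_image_of_mem _ hiB
      simpa using this
    calc s * (S.filter fun A => x ∈ A).card ≤ s * k := by gcongr
      _ ≤ S.card := (le_max_left _ _).trans hSc

/-- Iterating `exists_spread_of_card_lt` splits almost all of a family of `k`-sets into classes
spread out around `t`-element kernels. -/
theorem exists_spread_decomposition {α : Type*} [LinearOrder α] (k t s : ℕ)
    (ht : 2 * t + 1 ≤ k) :
    ∃ M : ℕ, ∀ (N : Finset α) (F : Finset (Finset α)), F ⊆ N.powersetCard k →
      ∃ F' ⊆ F, F.card ≤ M * N.card ^ (k - t - 1) + F'.card ∧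
        ∃ τ : Finset α → Finset α, (∀ A ∈ F', (τ A).card = t ∧ τ A ⊆ A) ∧
          ∀ T x, x ∉ T → s * (F'.filter fun A => τ A = T ∧ x ∈ A).card ≤
            (F'.filter fun A => τ A = T).card := by
  classical
  obtain ⟨M, hM⟩ := exists_spread_of_card_lt (α := α) k t s ht
  refine ⟨M, fun N F hF => ?_⟩
  induction hn : F.card using Nat.strong_induction_on generalizing F with
  | _ n ih =>
    by_cases hle : F.card ≤ M * N.card ^ (k - t - 1)
    · exact ⟨∅, by simp, by simpa [hn] using hle, fun _ => ∅, by simp, by simp⟩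
    · obtain ⟨T₀, hT₀, S, hSF, hSne, hST, hSs⟩ := hM N F hF (not_le.1 hle)
      have hsd := Finset.card_sdiff_add_card_eq_card hSF
      have hSpos := hSne.card_pos
      obtain ⟨F', hF', hcard, τ, hτ, hsp⟩ := ih (F \ S).card (by omega) (F \ S)
        (Finset.sdiff_subset.trans hF) rfl
      have hdisj : Disjoint F' S :=
        Finset.disjoint_of_subset_left hF' Finset.sdiff_disjoint
      have hnot : ∀ A ∈ F', A ∉ S := fun A hA => Finset.disjoint_left.1 hdisj hA
      refine ⟨F' ∪ S, Finset.union_subset (hF'.trans Finset.sdiff_subset) hSF, ?_,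
        fun A => if A ∈ S then T₀ else τ A, ?_, ?_⟩
      · rw [Finset.card_union_of_disjoint hdisj]
        omega
      · intro A hA
        by_cases h : A ∈ S
        · simpa [h, hT₀] using hST A h
        · simpa [h] using hτ A ((Finset.mem_union.1 hA).resolve_right h)
      · intro T x hx
        have hF1 : ∀ (p : Finset α → Prop) [DecidablePred p], F'.filter
            (fun A => (if A ∈ S then T₀ else τ A) = T ∧ p A) =
              F'.filter fun A => τ A = T ∧ p A := by
          intro p _
          refine Finset.filter_congr fun A hA => ?_
          rw [if_neg (hnot A hA)]
        have hS1 : ∀ (p : Finset α → Prop) [DecidablePred p], S.filter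
            (fun A => (if A ∈ S then T₀ else τ A) = T ∧ p A) =
              S.filter fun A => T₀ = T ∧ p A := by
          intro p _
          refine Finset.filter_congr fun A hA => ?_
          rw [if_pos hA]
        have hF2 := hF1 fun _ => True
        have hS2 := hS1 fun _ => True
        simp only [and_true] at hF2 hS2
        beta_reduce
        rw [Finset.filter_union, Finset.filter_union, hF1, hS1, hF2, hS2,
          Finset.card_union_of_disjoint (Finset.disjoint_filter_filter hdisj),
          Finset.card_union_of_disjoint (Finset.disjoint_filter_filter hdisj), mul_add]
        refine add_le_add (hsp T x hx) ?_
        by_cases h : T₀ = T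
        · subst h
          simpa using hSs x hx
        · simp [h]

theorem card_filter_offDiag_le_two_mul_rhoPairs (t : ℕ) (F : Finset (Finset ℕ)) :
    (F.offDiag.filter fun p => (p.1 ∩ p.2).card = t).card ≤ 2 * rhoPairs t F := by
  refine Finset.card_le_mul_card_image_of_maps_to
    (f := fun p : Finset ℕ × Finset ℕ => ({p.1, p.2} : Finset (Finset ℕ))) ?_ 2 ?_
  · rintro ⟨A, B⟩ hp
    simp only [Finset.mem_filter, Finset.mem_offDiag] at hp
    obtain ⟨⟨hA, hB, hne⟩, ht⟩ := hp
    simp only [Finset.mem_filter, Finset.mem_powersetCard]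
    refine ⟨⟨?_, Finset.card_pair hne⟩, A, by simp, B, by simp, hne, ht⟩
    simp [Finset.insert_subset_iff, hA, hB]
  · intro P hP
    simp only [Finset.mem_filter, Finset.mem_powersetCard] at hP
    obtain ⟨X, Y, -, rfl⟩ := Finset.card_eq_two.1 hP.1.2
    refine le_trans (Finset.card_le_card (t := {(X, Y), (Y, X)}) ?_) Finset.card_le_two
    rintro ⟨A, B⟩ hp
    simp only [Finset.mem_filter, Finset.mem_offDiag] at hp
    have hAB := hp.2
    have hne := hp.1.1.2.2
    have hA : A ∈ ({X, Y} : Finset (Finset ℕ)) := by rw [← hAB]; simp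
    have hB : B ∈ ({X, Y} : Finset (Finset ℕ)) := by rw [← hAB]; simp
    simp only [Finset.mem_insert, Finset.mem_singleton, Prod.mk.injEq] at hA hB ⊢
    grind

/-- In a family of `k`-sets spread out around `T`, almost all pairs meet exactly in `T`. -/
theorem mul_card_sq_le_of_spread {α : Type*} [DecidableEq α] (k s : ℕ) (T : Finset α)
    (G : Finset (Finset α)) (hG : ∀ A ∈ G, A.card = k ∧ T ⊆ A)
    (hs : ∀ x, x ∉ T → s * (G.filter fun A => x ∈ A).card ≤ G.card) :
    s * G.card ^ 2 ≤
      s * ((G ×ˢ G).filter fun p => p.1 ∩ p.2 = T).card + k * G.card ^ 2 := by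
  have hA : ∀ A ∈ G, s * G.card ≤ s * (G.filter fun B => A ∩ B = T).card + k * G.card := by
    intro A hA
    have hsub : (G.filter fun B => ¬A ∩ B = T) ⊆
        (A \ T).biUnion fun x => G.filter fun B => x ∈ B := by
      intro B hB
      rw [Finset.mem_filter] at hB
      obtain ⟨x, hx, hxT⟩ := Finset.exists_of_ssubset
        ((Finset.subset_inter (hG A hA).2 (hG B hB.1).2).ssubset_of_ne (Ne.symm hB.2))
      rw [Finset.mem_inter] at hx
      exact Finset.mem_biUnion.2
        ⟨x, Finset.mem_sdiff.2 ⟨hx.1, hxT⟩, Finset.mem_filter.2 ⟨hB.1, hx.2⟩⟩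
    have hne : s * (G.filter fun B => ¬A ∩ B = T).card ≤ k * G.card := by
      calc s * (G.filter fun B => ¬A ∩ B = T).card
          ≤ s * ∑ x ∈ A \ T, (G.filter fun B => x ∈ B).card :=
            Nat.mul_le_mul_left _ ((Finset.card_le_card hsub).trans Finset.card_biUnion_le)
        _ = ∑ x ∈ A \ T, s * (G.filter fun B => x ∈ B).card := Finset.mul_sum _ _ _
        _ ≤ ∑ _x ∈ A \ T, G.card :=
            Finset.sum_le_sum fun x hx => hs x (Finset.mem_sdiff.1 hx).2
        _ = (A \ T).card * G.card := by rw [Finset.sum_const, smul_eq_mul]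
        _ ≤ k * G.card := by
            gcongr
            exact (Finset.card_le_card Finset.sdiff_subset).trans (hG A hA).1.le
    calc s * G.card = s * (G.filter fun B => A ∩ B = T).card +
          s * (G.filter fun B => ¬A ∩ B = T).card := by
          rw [← mul_add, Finset.card_filter_add_card_filter_not]
      _ ≤ _ := Nat.add_le_add_left hne _
  have hpairs : ((G ×ˢ G).filter fun p => p.1 ∩ p.2 = T).card =
      ∑ A ∈ G, (G.filter fun B => A ∩ B = T).card := by
    simp only [Finset.card_filter, Finset.sum_product]
  calc s * G.card ^ 2 = ∑ _A ∈ G, s * G.card := by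
        rw [Finset.sum_const, smul_eq_mul]; ring
    _ ≤ ∑ A ∈ G, (s * (G.filter fun B => A ∩ B = T).card + k * G.card) :=
        Finset.sum_le_sum hA
    _ = _ := by
        rw [Finset.sum_add_distrib, ← Finset.mul_sum, ← hpairs, Finset.sum_const, smul_eq_mul]
        ring

/-- Up to `O(|N| ^ (k - t - 1))` members, a family of `k`-subsets of `N` spans many pairs meeting
in `t` elements. -/
theorem exists_mul_sq_le_rhoPairs (k t s : ℕ) (ht : 2 * t + 1 ≤ k) :
    ∃ M : ℕ, ∀ (N : Finset ℕ) (F : Finset (Finset ℕ)), F ⊆ N.powersetCard k →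
      ∃ m : ℕ, F.card ≤ M * N.card ^ (k - t - 1) + m ∧
        (s - k) * m ^ 2 ≤ N.card.choose t * (s * (2 * rhoPairs t F)) := by
  obtain ⟨M, hM⟩ := exists_spread_decomposition (α := ℕ) k t s ht
  refine ⟨M, fun N F hF => ?_⟩
  obtain ⟨F', hF', hcard, τ, hτ, hsp⟩ := hM N F hF
  refine ⟨F'.card, hcard, ?_⟩
  have hk : ∀ A ∈ F', A ⊆ N ∧ A.card = k := fun A hA => Finset.mem_powersetCard.1 (hF (hF' hA))
  set P := N.powersetCard t with hP
  set G : Finset ℕ → Finset (Finset ℕ) := fun T => F'.filter fun A => τ A = T with hG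
  set D := ∑ T ∈ P, (G T).card ^ 2 with hD
  have hsum : F'.card = ∑ T ∈ P, (G T).card :=
    Finset.card_eq_sum_card_fiberwise fun A hA =>
      Finset.mem_powersetCard.2 ⟨(hτ A hA).2.trans (hk A hA).1, (hτ A hA).1⟩
  have hCS : F'.card ^ 2 ≤ N.card.choose t * D := by
    rw [hsum, ← Finset.card_powersetCard]
    exact sq_sum_le_card_mul_sum_sq
  have hpairs : ∑ T ∈ P, ((G T ×ˢ G T).filter fun p => p.1 ∩ p.2 = T).card ≤
      2 * rhoPairs t F := by
    refine le_trans ?_ (card_filter_offDiag_le_two_mul_rhoPairs t F)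
    rw [Finset.card_eq_sum_card_fiberwise (f := fun p => p.1 ∩ p.2) (t := P)]
    · refine Finset.sum_le_sum fun T hT => Finset.card_le_card ?_
      rintro ⟨A, B⟩ hp
      simp only [hG, Finset.mem_filter, Finset.mem_product, Finset.mem_offDiag] at hp ⊢
      have hTt := (Finset.mem_powersetCard.1 hT).2
      refine ⟨⟨⟨hF' hp.1.1.1, hF' hp.1.2.1, ?_⟩, by rw [hp.2, hTt]⟩, hp.2⟩
      rintro rfl
      have h1 := (hk A hp.1.1.1).2
      rw [Finset.inter_self] at hp
      rw [hp.2] at h1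
      omega
    · rintro ⟨A, B⟩ hp
      simp only [Finset.coe_filter, Set.mem_ofPred_eq, Finset.mem_offDiag] at hp
      exact Finset.mem_coe.2 (Finset.mem_powersetCard.2
        ⟨Finset.inter_subset_left.trans (Finset.mem_powersetCard.1 (hF hp.1.1)).1, hp.2⟩)
  have hmain : s * D ≤ s * (2 * rhoPairs t F) + k * D := by
    calc s * D = ∑ T ∈ P, s * (G T).card ^ 2 := Finset.mul_sum _ _ _
      _ ≤ ∑ T ∈ P, (s * ((G T ×ˢ G T).filter fun p => p.1 ∩ p.2 = T).card +
            k * (G T).card ^ 2) := by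
          refine Finset.sum_le_sum fun T _ => mul_card_sq_le_of_spread k s T (G T) ?_ ?_
          · intro A hA
            obtain ⟨hA', rfl⟩ := Finset.mem_filter.1 hA
            exact ⟨(hk A hA').2, (hτ A hA').2⟩
          · intro x hx
            rw [Finset.filter_filter]
            exact hsp T x hx
      _ = s * ∑ T ∈ P, ((G T ×ˢ G T).filter fun p => p.1 ∩ p.2 = T).card + k * D := by
          rw [Finset.sum_add_distrib, ← Finset.mul_sum, ← Finset.mul_sum]
      _ ≤ s * (2 * rhoPairs t F) + k * D := by gcongr
  calc (s - k) * F'.card ^ 2 ≤ (s - k) * (N.card.choose t * D) := by gcongr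
    _ = N.card.choose t * ((s - k) * D) := by ring
    _ ≤ N.card.choose t * (s * (2 * rhoPairs t F)) := by
        refine Nat.mul_le_mul_left _ ?_
        rw [Nat.sub_mul]
        omega

theorem exists_rhoPairs_eq_rhoMin {n k ℓ : ℕ} (t : ℕ) (hℓ : ℓ ≤ n.choose k) :
    ∃ F ⊆ (Finset.Icc 1 n).powersetCard k, F.card = ℓ ∧ rhoPairs t F = rhoMin n k t ℓ := by
  obtain ⟨F, hF, hc⟩ := Finset.exists_subset_card_eq
    (s := (Finset.Icc 1 n).powersetCard k) (n := ℓ) (by simpa using hℓ)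
  exact Nat.sInf_mem (s := { m : ℕ | ∃ F : Finset (Finset ℕ),
    F ⊆ (Finset.Icc 1 n).powersetCard k ∧ F.card = ℓ ∧ rhoPairs t F = m }) ⟨_, F, hF, hc, rfl⟩

/-- Theorem 4: lower bound `ρ(ℓ) ≥ (1-o(1)) ⋅ ℓ² ⋅ t! / (2nᵗ)` for `ℓ ≫ n^{k-t-1}`. -/
theorem rho_lower_main (k t : ℕ) (ht : 0 < t) (h : 2 * t + 1 ≤ k) :
    ∀ ε : ℝ, 0 < ε → ∃ C : ℝ, 0 < C ∧ ∃ n₀ : ℕ, ∀ n > n₀, ∀ ℓ : ℕ,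
      C * (n : ℝ) ^ (k - t - 1) ≤ (ℓ : ℝ) → ℓ ≤ n.choose k →
      (1 - ε) * (ℓ : ℝ) ^ 2 * (t.factorial : ℝ) / (2 * (n : ℝ) ^ t)
        ≤ (rhoMin n k t ℓ : ℝ) := by
  intro ε hε
  obtain hε1 | hε1 := le_or_gt 1 ε
  · refine ⟨1, one_pos, 0, fun n _ ℓ _ _ => le_trans ?_ (Nat.cast_nonneg _)⟩
    refine div_nonpos_of_nonpos_of_nonneg ?_ (by positivity)
    rw [mul_assoc]
    exact mul_nonpos_of_nonpos_of_nonneg (by linarith) (by positivity)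
  obtain ⟨s, hs⟩ := exists_nat_gt (3 * k / ε)
  have hks : (k : ℝ) ≤ ε / 3 * s := by
    rw [div_lt_iff₀ hε] at hs
    linarith
  have hs0 : (0 : ℝ) < s := lt_of_le_of_lt (by positivity) hs
  obtain ⟨M, hM⟩ := exists_mul_sq_le_rhoPairs k t s h
  refine ⟨3 * (M + 1) / ε, by positivity, 0, fun n hn ℓ hℓ hℓk => ?_⟩
  obtain ⟨F, hF, hFc, hFρ⟩ := exists_rhoPairs_eq_rhoMin t hℓk
  obtain ⟨m, hm, hle⟩ := hM _ F hF
  rw [Nat.card_Icc, Nat.add_sub_cancel, hFc] at hm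
  rw [Nat.card_Icc, Nat.add_sub_cancel, hFρ] at hle
  set ρ := rhoMin n k t ℓ
  have hn' : (0 : ℝ) < n := by exact_mod_cast hn
  have hmℓ : (1 - ε / 3) * (ℓ : ℝ) ≤ m := by
    have h1 : (ℓ : ℝ) ≤ M * (n : ℝ) ^ (k - t - 1) + m := by exact_mod_cast hm
    have h2 : (3 * (M + 1) : ℝ) * (n : ℝ) ^ (k - t - 1) ≤ ε * ℓ := by
      rw [div_mul_eq_mul_div, div_le_iff₀ hε] at hℓ
      linarith
    have h3 : (0 : ℝ) < (n : ℝ) ^ (k - t - 1) := by positivity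
    linarith
  have hle' : ((s : ℝ) - k) * (m : ℝ) ^ 2 ≤ (n.choose t : ℝ) * (s * (2 * ρ)) := by
    have h1 : ((s - k : ℕ) : ℝ) * (m : ℝ) ^ 2 ≤ (n.choose t : ℝ) * (s * (2 * ρ)) := by
      exact_mod_cast hle
    refine le_trans ?_ h1
    gcongr
    exact tsub_le_iff_right.2 (by exact_mod_cast (by omega : s ≤ s - k + k))
  have hδ : 0 < 1 - ε / 3 := by linarith
  have hch : (n.choose t : ℝ) * t.factorial ≤ (n : ℝ) ^ t := by
    rw [← le_div_iff₀ (by positivity)]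
    exact Nat.choose_le_pow_div t n
  have hcube : 1 - ε ≤ (1 - ε / 3) ^ 3 := by
    nlinarith [sq_nonneg ε, mul_pos hε hε]
  have hkey : (s : ℝ) * ((1 - ε) * (ℓ : ℝ) ^ 2 * t.factorial) ≤ s * (ρ * (2 * (n : ℝ) ^ t)) := by
    calc (s : ℝ) * ((1 - ε) * (ℓ : ℝ) ^ 2 * t.factorial)
        ≤ s * ((1 - ε / 3) ^ 3 * (ℓ : ℝ) ^ 2 * t.factorial) := by gcongr
      _ = ((1 - ε / 3) * s) * ((1 - ε / 3) * (ℓ : ℝ)) ^ 2 * t.factorial := by ring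
      _ ≤ ((s : ℝ) - k) * (m : ℝ) ^ 2 * t.factorial := by
          have h1 : (1 - ε / 3) * s ≤ (s : ℝ) - k := by linarith
          have h2 : 0 ≤ (s : ℝ) - k := le_trans (by positivity) h1
          gcongr
      _ ≤ (n.choose t : ℝ) * (s * (2 * ρ)) * t.factorial := by gcongr
      _ = (s * (2 * ρ)) * ((n.choose t : ℝ) * t.factorial) := by ring
      _ ≤ (s * (2 * ρ)) * (n : ℝ) ^ t := by gcongr
      _ = s * (ρ * (2 * (n : ℝ) ^ t)) := by ring
  rw [div_le_iff₀ (by positivity)]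
  exact le_of_mul_le_mul_left hkey hs0
end
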